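/- arXiv:1801.07611 — 4 statements merged into one kernel-verified Lean document; each statement's English description precedes it below -/
import Mathlib

section
/- Let r1, s1, r2, s2 be nonzero integers, x1, y1, x2, y2 integers and D1, D2 positive integers. Then Ŝ_{r1,s1,r2,s2}(x1, y1, x2, y2; D1, D2) = 0 unless both congruences x1·y1 ≡ r1·s1·D2 (mod D1) and x2·y2 ≡ r2·s2·D1 (mod D2) hold. -/
open MeasureTheory Finset Set
open scoped Real

noncomputable section

/-- `e(x) = exp(2πi x)`. -/
def eFn (x : ℝ) : ℂ := Complex.exp (2 * (Real.pi : ℂ) * Complex.I * (x : ℂ))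

open Classical in
/-- A choice of a Bézout pair `(Y, Z)` with `Y·B + Z·C ≡ 1 (mod D)`, when one exists
(the Kloosterman sum below does not depend on this choice). -/
def bezout (B C : ℤ) (D : ℕ) : ℤ × ℤ :=
  if h : ∃ p : ℤ × ℤ, (p.1 * B + p.2 * C) % (D : ℤ) = 1 % (D : ℤ) then h.choose else (0, 0)

/-- The long-Weyl-element GL(3) Kloosterman sum
`S(n₁,m₂,m₁,n₂;D₁,D₂) = Σ e((n₁B₁ + m₁(Y₁D₂ − Z₁B₂))/D₁ + (m₂B₂ + n₂(Y₂D₁ − Z₂B₁))/D₂)`,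
the sum running over `B₁, C₁ mod D₁` and `B₂, C₂ mod D₂` subject to
`D₁C₂ + B₁B₂ + D₂C₁ ≡ 0 mod D₁D₂` and `(Bⱼ, Cⱼ, Dⱼ) = 1`, with `YⱼBⱼ + ZⱼCⱼ ≡ 1 mod Dⱼ`. -/
def longS (n1 m2 m1 n2 : ℤ) (D1 D2 : ℕ) : ℂ :=
  ∑ B1 ∈ Finset.range D1, ∑ C1 ∈ Finset.range D1,
    ∑ B2 ∈ Finset.range D2, ∑ C2 ∈ Finset.range D2,
      if (D1 * D2 ∣ D1 * C2 + B1 * B2 + D2 * C1)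
          ∧ Nat.gcd (Nat.gcd B1 C1) D1 = 1 ∧ Nat.gcd (Nat.gcd B2 C2) D2 = 1 then
        eFn (((n1 * (B1 : ℤ) + m1 * ((bezout (B1 : ℤ) (C1 : ℤ) D1).1 * (D2 : ℤ)
                - (bezout (B1 : ℤ) (C1 : ℤ) D1).2 * (B2 : ℤ)) : ℤ) : ℝ) / (D1 : ℝ)
          + ((m2 * (B2 : ℤ) + n2 * ((bezout (B2 : ℤ) (C2 : ℤ) D2).1 * (D1 : ℤ)
                - (bezout (B2 : ℤ) (C2 : ℤ) D2).2 * (B1 : ℤ)) : ℤ) : ℝ) / (D2 : ℝ))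
      else 0

/-- The finite Fourier transform
`Ŝ_{r₁,s₁,r₂,s₂}(x₁,y₁,x₂,y₂;D₁,D₂) = (1/(D₁²D₂²)) Σ_{n₁,m₁ mod D₁} Σ_{n₂,m₂ mod D₂}
  S(n₁r₁, m₂r₂, m₁s₁, n₂s₂; D₁, D₂) e(−(x₁m₁ + y₁n₁)/D₁ − (x₂m₂ + y₂n₂)/D₂)`. -/
def Shat (r1 s1 r2 s2 : ℤ) (x1 y1 x2 y2 : ℤ) (D1 D2 : ℕ) : ℂ :=
  (1 / ((D1 : ℂ) ^ 2 * (D2 : ℂ) ^ 2)) *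
    ∑ n1 ∈ Finset.range D1, ∑ m1 ∈ Finset.range D1,
      ∑ n2 ∈ Finset.range D2, ∑ m2 ∈ Finset.range D2,
        longS ((n1 : ℤ) * r1) ((m2 : ℤ) * r2) ((m1 : ℤ) * s1) ((n2 : ℤ) * s2) D1 D2 *
          eFn (-(((x1 * (m1 : ℤ) + y1 * (n1 : ℤ) : ℤ) : ℝ) / (D1 : ℝ))
            - ((x2 * (m2 : ℤ) + y2 * (n2 : ℤ) : ℤ) : ℝ) / (D2 : ℝ))

lemma eFn_add (x y : ℝ) : eFn (x + y) = eFn x * eFn y := by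
  unfold eFn
  rw [← Complex.exp_add]
  congr 1
  push_cast
  ring

lemma sum_eFn_zero (D : ℕ) (hD : 0 < D) (a : ℤ) (ha : ¬ (D : ℤ) ∣ a) :
    ∑ n ∈ Finset.range D, eFn ((n : ℝ) * ((a : ℝ) / (D : ℝ))) = 0 := by
  have hDc : (D : ℂ) ≠ 0 := by exact_mod_cast hD.ne'
  have hpi : (2 * (Real.pi : ℂ) * Complex.I) ≠ 0 := Complex.two_pi_I_ne_zero
  have h1 : ∀ n : ℕ, eFn ((n : ℝ) * ((a : ℝ) / (D : ℝ))) = (eFn ((a : ℝ) / (D : ℝ))) ^ n := by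
    intro n
    unfold eFn
    rw [← Complex.exp_nat_mul]
    congr 1
    push_cast
    ring
  have hpow : (eFn ((a : ℝ) / (D : ℝ))) ^ D = 1 := by
    rw [← h1]
    unfold eFn
    rw [Complex.exp_eq_one_iff]
    refine ⟨a, ?_⟩
    push_cast
    field_simp
  have hne : eFn ((a : ℝ) / (D : ℝ)) ≠ 1 := by
    intro h
    unfold eFn at h
    rw [Complex.exp_eq_one_iff] at h
    obtain ⟨k, hk⟩ := h
    apply ha
    refine ⟨k, ?_⟩
    rw [mul_comm] at hk
    have h2 := mul_right_cancel₀ hpi hk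
    push_cast at h2
    rw [div_eq_iff hDc] at h2
    have h3 : a = k * D := by exact_mod_cast h2
    rw [h3, mul_comm]
  simp_rw [h1]
  rw [geom_sum_eq hne, hpow]
  simp

lemma sum4_zero (D1 D2 : ℕ) (hD1 : 0 < D1) (hD2 : 0 < D2) (a b c d : ℤ)
    (h : ¬ ((D1 : ℤ) ∣ a ∧ (D1 : ℤ) ∣ b ∧ (D2 : ℤ) ∣ c ∧ (D2 : ℤ) ∣ d)) :
    ∑ n1 ∈ Finset.range D1, ∑ m1 ∈ Finset.range D1,
      ∑ n2 ∈ Finset.range D2, ∑ m2 ∈ Finset.range D2,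
        (eFn ((n1 : ℝ) * ((a : ℝ) / (D1 : ℝ))) * (eFn ((m1 : ℝ) * ((b : ℝ) / (D1 : ℝ))) *
          (eFn ((n2 : ℝ) * ((c : ℝ) / (D2 : ℝ))) * eFn ((m2 : ℝ) * ((d : ℝ) / (D2 : ℝ)))))) = 0 := by
  simp_rw [← Finset.mul_sum, ← Finset.sum_mul]
  by_cases h1 : (D1 : ℤ) ∣ a
  · by_cases h2 : (D1 : ℤ) ∣ b
    · by_cases h3 : (D2 : ℤ) ∣ c
      · have h4 : ¬ (D2 : ℤ) ∣ d := fun h4 => h ⟨h1, h2, h3, h4⟩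
        rw [sum_eFn_zero D2 hD2 d h4]; simp
      · rw [sum_eFn_zero D2 hD2 c h3]; simp
    · rw [sum_eFn_zero D1 hD1 b h2]; simp
  · rw [sum_eFn_zero D1 hD1 a h1]; simp

lemma bezout_spec (B C D : ℕ) (h : Nat.gcd (Nat.gcd B C) D = 1) :
    (D : ℤ) ∣ (bezout (B : ℤ) (C : ℤ) D).1 * B + (bezout (B : ℤ) (C : ℤ) D).2 * C - 1 := by
  have hex : ∃ p : ℤ × ℤ, (p.1 * B + p.2 * C) % (D : ℤ) = 1 % (D : ℤ) := by
    have e1 := Nat.gcd_eq_gcd_ab (Nat.gcd B C) D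
    have e2 := Nat.gcd_eq_gcd_ab B C
    rw [h, e2] at e1
    refine ⟨(Nat.gcdA B C * Nat.gcdA (Nat.gcd B C) D, Nat.gcdB B C * Nat.gcdA (Nat.gcd B C) D), ?_⟩
    apply Int.emod_emod_of_dvd _ (dvd_refl _) |>.symm.trans
    rw [Int.emod_emod_of_dvd _ (dvd_refl _)]
    apply Int.ModEq.symm
    rw [Int.modEq_iff_dvd]
    refine ⟨- Nat.gcdB (Nat.gcd B C) D, ?_⟩
    push_cast at e1
    linear_combination -e1
  have hs : bezout (B : ℤ) (C : ℤ) D = hex.choose := by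
    unfold bezout
    rw [dif_pos hex]
  rw [hs]
  have := hex.choose_spec
  exact (Int.modEq_iff_dvd).1 (Int.ModEq.symm this)

/-- the core congruence -/
lemma core_congr (D E B C B' Y Z r s x y : ℤ) (hdiv : D ∣ B * B' + E * C)
    (hb : D ∣ Y * B + Z * C - 1) (h1 : D ∣ r * B - y) (h2 : D ∣ s * (Y * E - Z * B') - x) :
    x * y ≡ r * s * E [ZMOD D] := by
  rw [Int.modEq_iff_dvd]
  obtain ⟨u, hu⟩ := hdiv
  obtain ⟨v, hv⟩ := hb
  obtain ⟨w, hw⟩ := h1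
  obtain ⟨t, ht⟩ := h2
  refine ⟨x * w + r * B * t + r * s * Z * u - r * s * E * v, ?_⟩
  linear_combination x * hw + r * B * ht + r * s * Z * hu - r * s * E * hv

lemma sum_quad (a b c d : Finset ℕ) (f : ℕ → ℕ → ℕ → ℕ → ℂ) :
    ∑ i ∈ a, ∑ j ∈ b, ∑ k ∈ c, ∑ l ∈ d, f i j k l =
      ∑ p ∈ a ×ˢ b ×ˢ c ×ˢ d, f p.1 p.2.1 p.2.2.1 p.2.2.2 := by
  simp only [Finset.sum_product]

lemma swap_zero (a b c d a' b' c' d' : Finset ℕ)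
    (F : ℕ → ℕ → ℕ → ℕ → ℕ → ℕ → ℕ → ℕ → ℂ)
    (h : ∀ i' j' k' l', ∑ i ∈ a, ∑ j ∈ b, ∑ k ∈ c, ∑ l ∈ d, F i j k l i' j' k' l' = 0) :
    ∑ i ∈ a, ∑ j ∈ b, ∑ k ∈ c, ∑ l ∈ d,
      ∑ i' ∈ a', ∑ j' ∈ b', ∑ k' ∈ c', ∑ l' ∈ d', F i j k l i' j' k' l' = 0 := by
  rw [sum_quad a b c d
    (fun i j k l => ∑ i' ∈ a', ∑ j' ∈ b', ∑ k' ∈ c', ∑ l' ∈ d', F i j k l i' j' k' l')]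
  have h2 : ∀ p : ℕ × ℕ × ℕ × ℕ,
      ∑ i' ∈ a', ∑ j' ∈ b', ∑ k' ∈ c', ∑ l' ∈ d', F p.1 p.2.1 p.2.2.1 p.2.2.2 i' j' k' l' =
      ∑ q ∈ a' ×ˢ b' ×ˢ c' ×ˢ d', F p.1 p.2.1 p.2.2.1 p.2.2.2 q.1 q.2.1 q.2.2.1 q.2.2.2 :=
    fun p => sum_quad a' b' c' d' (F p.1 p.2.1 p.2.2.1 p.2.2.2)
  rw [Finset.sum_congr rfl (fun p _ => h2 p), Finset.sum_comm]
  refine Finset.sum_eq_zero fun q _ => ?_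
  rw [← h q.1 q.2.1 q.2.2.1 q.2.2.2,
    sum_quad a b c d (fun i j k l => F i j k l q.1 q.2.1 q.2.2.1 q.2.2.2)]

theorem statement3 (r1 s1 r2 s2 : ℤ) (hr1 : r1 ≠ 0) (hs1 : s1 ≠ 0) (hr2 : r2 ≠ 0)
    (hs2 : s2 ≠ 0) (x1 y1 x2 y2 : ℤ) (D1 D2 : ℕ) (hD1 : 0 < D1) (hD2 : 0 < D2)
    (h : ¬(x1 * y1 ≡ r1 * s1 * (D2 : ℤ) [ZMOD (D1 : ℤ)] ∧
           x2 * y2 ≡ r2 * s2 * (D1 : ℤ) [ZMOD (D2 : ℤ)])) :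
    Shat r1 s1 r2 s2 x1 y1 x2 y2 D1 D2 = 0 := by
  unfold Shat longS
  refine mul_eq_zero_of_right _ ?_
  simp_rw [Finset.sum_mul]
  apply swap_zero
  intro B1 C1 B2 C2
  split_ifs with hc
  · obtain ⟨hdiv, hg1, hg2⟩ := hc
    have hb1 := bezout_spec B1 C1 D1 hg1
    have hb2 := bezout_spec B2 C2 D2 hg2
    set Y1 := (bezout (B1 : ℤ) (C1 : ℤ) D1).1
    set Z1 := (bezout (B1 : ℤ) (C1 : ℤ) D1).2
    set Y2 := (bezout (B2 : ℤ) (C2 : ℤ) D2).1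
    set Z2 := (bezout (B2 : ℤ) (C2 : ℤ) D2).2
    have key := sum4_zero D1 D2 hD1 hD2 (r1 * B1 - y1) (s1 * (Y1 * D2 - Z1 * B2) - x1)
      (s2 * (Y2 * D1 - Z2 * B1) - y2) (r2 * B2 - x2) ?_
    · rw [← key]
      refine Finset.sum_congr rfl fun n1 _ => Finset.sum_congr rfl fun m1 _ =>
        Finset.sum_congr rfl fun n2 _ => Finset.sum_congr rfl fun m2 _ => ?_
      simp only [← eFn_add]
      congr 1
      push_cast
      ring
    · rintro ⟨k1, k2, k3, k4⟩
      have hdz : ((D1 : ℤ) * D2) ∣ D1 * C2 + B1 * B2 + D2 * C1 := by exact_mod_cast hdiv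
      obtain ⟨q, hq⟩ := hdz
      apply h
      constructor
      · exact core_congr D1 D2 B1 C1 B2 Y1 Z1 r1 s1 x1 y1
          ⟨D2 * q - C2, by linear_combination hq⟩ hb1 k1 k2
      · have := core_congr D2 D1 B2 C2 B1 Y2 Z2 r2 s2 y2 x2
          ⟨D1 * q - C1, by linear_combination hq⟩ hb2 k4 k3
        rwa [mul_comm y2 x2] at this
  · simp
end
end

section
/- Let r1, s1, r2, s2 be nonzero integers with gcd(r1·r2, s1·s2) = 1, and let D1, D2 be positive integers. Then Ŝ_{r1,s1,r2,s2}(0, 0, 0, 0; D1, D2) = 0 unless D1 = D2, and if D1 = D2 then Ŝ_{r1,s1,r2,s2}(0, 0, 0, 0; D1, D2) = φ(D1), where φ is Euler's totient function. -/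
open MeasureTheory Finset Set
open scoped Real

noncomputable section

lemma eFn_zero : eFn 0 = 1 := by simp [eFn]

lemma eFn_nsmul (n : ℕ) (x : ℝ) : eFn (n * x) = eFn x ^ n := by
  unfold eFn
  rw [← Complex.exp_nat_mul]
  congr 1
  push_cast
  ring

lemma eFn_eq_one_iff (a : ℤ) (D : ℕ) (hD : 0 < D) :
    eFn ((a : ℝ) / (D : ℝ)) = 1 ↔ (D : ℤ) ∣ a := by
  have hD' : (D : ℂ) ≠ 0 := by exact_mod_cast hD.ne'
  have hpi : (2 * (Real.pi : ℂ) * Complex.I) ≠ 0 := Complex.two_pi_I_ne_zero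
  unfold eFn
  rw [Complex.exp_eq_one_iff]
  constructor
  · rintro ⟨n, hn⟩
    rw [mul_comm (n : ℂ)] at hn
    have h2 := mul_left_cancel₀ hpi hn
    push_cast at h2
    rw [div_eq_iff hD'] at h2
    refine ⟨n, ?_⟩
    have h3 : a = n * (D : ℤ) := by exact_mod_cast h2
    rw [h3, mul_comm]
  · rintro ⟨n, rfl⟩
    refine ⟨n, ?_⟩
    push_cast
    field_simp

lemma sum_eFn (a : ℤ) (D : ℕ) (hD : 0 < D) :
    ∑ n ∈ Finset.range D, eFn ((n : ℝ) * ((a : ℝ) / (D : ℝ))) =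
      if (D : ℤ) ∣ a then (D : ℂ) else 0 := by
  simp_rw [eFn_nsmul]
  split_ifs with h
  · rw [(eFn_eq_one_iff a D hD).2 h]
    simp
  · have h1 : eFn ((a : ℝ) / (D : ℝ)) ≠ 1 := fun h2 => h ((eFn_eq_one_iff a D hD).1 h2)
    rw [geom_sum_eq h1, ← eFn_nsmul]
    have hD' : (D : ℝ) ≠ 0 := by exact_mod_cast hD.ne'
    have : (D : ℝ) * ((a : ℝ) / D) = (a : ℝ) / ((1 : ℕ) : ℝ) := by
      field_simp
      simp
    rw [this, (eFn_eq_one_iff a 1 one_pos).2 (by simp)]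
    simp

lemma sum4_eFn (a b c d : ℤ) (D1 D2 : ℕ) (h1 : 0 < D1) (h2 : 0 < D2) :
    ∑ n1 ∈ Finset.range D1, ∑ m1 ∈ Finset.range D1,
      ∑ n2 ∈ Finset.range D2, ∑ m2 ∈ Finset.range D2,
      eFn ((((n1 : ℤ) * a + (m1 : ℤ) * b : ℤ) : ℝ) / (D1 : ℝ) +
        (((m2 : ℤ) * c + (n2 : ℤ) * d : ℤ) : ℝ) / (D2 : ℝ)) =
    if (D1 : ℤ) ∣ a ∧ (D1 : ℤ) ∣ b ∧ (D2 : ℤ) ∣ c ∧ (D2 : ℤ) ∣ d then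
      (D1 : ℂ) ^ 2 * (D2 : ℂ) ^ 2 else 0 := by
  have key : ∀ n1 m1 n2 m2 : ℕ,
      eFn ((((n1 : ℤ) * a + (m1 : ℤ) * b : ℤ) : ℝ) / (D1 : ℝ) +
        (((m2 : ℤ) * c + (n2 : ℤ) * d : ℤ) : ℝ) / (D2 : ℝ)) =
      eFn ((n1 : ℝ) * ((a : ℝ) / D1)) * (eFn ((m1 : ℝ) * ((b : ℝ) / D1)) *
        (eFn ((n2 : ℝ) * ((d : ℝ) / D2)) * eFn ((m2 : ℝ) * ((c : ℝ) / D2)))) := by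
    intro n1 m1 n2 m2
    rw [← eFn_add, ← eFn_add, ← eFn_add]
    congr 1
    push_cast
    ring
  simp_rw [key, ← Finset.mul_sum, ← Finset.sum_mul]
  rw [sum_eFn _ _ h1, sum_eFn _ _ h1, sum_eFn _ _ h2, sum_eFn _ _ h2]
  by_cases ha : (D1 : ℤ) ∣ a <;> by_cases hb : (D1 : ℤ) ∣ b <;>
    by_cases hc : (D2 : ℤ) ∣ c <;> by_cases hd : (D2 : ℤ) ∣ d <;> simp [ha, hb, hc, hd]
  ring

/-- The full condition counted by `Shat` at the origin. -/
def CondK (D1 D2 : ℕ) (t : ℕ × ℕ × ℕ × ℕ) : Prop :=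
  (D1 * D2 ∣ D1 * t.2.2.2 + t.1 * t.2.2.1 + D2 * t.2.1)
    ∧ Nat.gcd (Nat.gcd t.1 t.2.1) D1 = 1 ∧ Nat.gcd (Nat.gcd t.2.2.1 t.2.2.2) D2 = 1

def CondF (r1 s1 r2 s2 : ℤ) (D1 D2 : ℕ) (t : ℕ × ℕ × ℕ × ℕ) : Prop :=
  (D1 : ℤ) ∣ r1 * t.1 ∧
  (D1 : ℤ) ∣ s1 * ((bezout (t.1 : ℤ) (t.2.1 : ℤ) D1).1 * (D2 : ℤ)
                - (bezout (t.1 : ℤ) (t.2.1 : ℤ) D1).2 * (t.2.2.1 : ℤ)) ∧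
  (D2 : ℤ) ∣ r2 * t.2.2.1 ∧
  (D2 : ℤ) ∣ s2 * ((bezout (t.2.2.1 : ℤ) (t.2.2.2 : ℤ) D2).1 * (D1 : ℤ)
                - (bezout (t.2.2.1 : ℤ) (t.2.2.2 : ℤ) D2).2 * (t.1 : ℤ))

def rng4 (D1 D2 : ℕ) : Finset (ℕ × ℕ × ℕ × ℕ) :=
  Finset.range D1 ×ˢ Finset.range D1 ×ˢ Finset.range D2 ×ˢ Finset.range D2

open Classical in
lemma Shat_eq_card (r1 s1 r2 s2 : ℤ) (D1 D2 : ℕ) (h1 : 0 < D1) (h2 : 0 < D2) :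
    Shat r1 s1 r2 s2 0 0 0 0 D1 D2 =
      (((rng4 D1 D2).filter (fun t => CondK D1 D2 t ∧ CondF r1 s1 r2 s2 D1 D2 t)).card : ℂ) := by
  have hD1 : (D1 : ℂ) ≠ 0 := by exact_mod_cast h1.ne'
  have hD2 : (D2 : ℂ) ≠ 0 := by exact_mod_cast h2.ne'
  have hL : ∀ n1 m2 m1 n2 : ℤ, longS n1 m2 m1 n2 D1 D2 = ∑ t ∈ rng4 D1 D2,
      if CondK D1 D2 t then
        eFn (((n1 * (t.1 : ℤ) + m1 * ((bezout (t.1 : ℤ) (t.2.1 : ℤ) D1).1 * (D2 : ℤ)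
                - (bezout (t.1 : ℤ) (t.2.1 : ℤ) D1).2 * (t.2.2.1 : ℤ)) : ℤ) : ℝ) / (D1 : ℝ)
          + ((m2 * (t.2.2.1 : ℤ) + n2 * ((bezout (t.2.2.1 : ℤ) (t.2.2.2 : ℤ) D2).1 * (D1 : ℤ)
                - (bezout (t.2.2.1 : ℤ) (t.2.2.2 : ℤ) D2).2 * (t.1 : ℤ)) : ℤ) : ℝ) / (D2 : ℝ))
      else 0 := by
    intro n1 m2 m1 n2
    unfold longS rng4 CondK
    simp only [Finset.sum_product]
  have hS : ∑ n1 ∈ Finset.range D1, ∑ m1 ∈ Finset.range D1,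
      ∑ n2 ∈ Finset.range D2, ∑ m2 ∈ Finset.range D2,
        longS ((n1 : ℤ) * r1) ((m2 : ℤ) * r2) ((m1 : ℤ) * s1) ((n2 : ℤ) * s2) D1 D2 =
      ∑ t ∈ rng4 D1 D2, if CondK D1 D2 t ∧ CondF r1 s1 r2 s2 D1 D2 t then
        (D1 : ℂ) ^ 2 * (D2 : ℂ) ^ 2 else 0 := by
    have e1 : ∀ f : ℕ → ℕ → ℕ → ℕ → ℂ, ∑ n1 ∈ Finset.range D1, ∑ m1 ∈ Finset.range D1,
      ∑ n2 ∈ Finset.range D2, ∑ m2 ∈ Finset.range D2, f n1 m1 n2 m2 =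
        ∑ u ∈ rng4 D1 D2, f u.1 u.2.1 u.2.2.1 u.2.2.2 := by
      intro f
      unfold rng4
      simp only [Finset.sum_product]
    rw [e1]
    simp_rw [hL]
    rw [Finset.sum_comm]
    refine Finset.sum_congr rfl fun t _ => ?_
    by_cases hK : CondK D1 D2 t
    · simp only [hK, if_true, true_and]
      have := sum4_eFn (r1 * t.1) (s1 * ((bezout (t.1 : ℤ) (t.2.1 : ℤ) D1).1 * (D2 : ℤ)
                - (bezout (t.1 : ℤ) (t.2.1 : ℤ) D1).2 * (t.2.2.1 : ℤ))) (r2 * t.2.2.1)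
        (s2 * ((bezout (t.2.2.1 : ℤ) (t.2.2.2 : ℤ) D2).1 * (D1 : ℤ)
                - (bezout (t.2.2.1 : ℤ) (t.2.2.2 : ℤ) D2).2 * (t.1 : ℤ))) D1 D2 h1 h2
      rw [e1] at this
      simp only [mul_assoc]
      unfold CondF
      rw [this]
      congr 1
    · simp [hK]
  unfold Shat
  have h0 : ∀ m n m' n' : ℕ, eFn (-(((0 * (m : ℤ) + 0 * (n : ℤ) : ℤ) : ℝ) / (D1 : ℝ))
            - ((0 * (m' : ℤ) + 0 * (n' : ℤ) : ℤ) : ℝ) / (D2 : ℝ)) = 1 := by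
    intro m n m' n'
    simp [eFn_zero]
  simp only [h0, mul_one]
  rw [hS, ← Finset.sum_filter, Finset.sum_const, nsmul_eq_mul]
  field_simp

/-- Choice-free form of one of the divisibility conditions. -/
lemma cond_iff (s Y Z B C E D2 D1 : ℤ) (hYZ : D1 ∣ Y * B + Z * C - 1)
    (hrel : D1 ∣ B * E + D2 * C) :
    D1 ∣ s * (Y * D2 - Z * E) ↔ D1 ∣ s * D2 ∧ D1 ∣ s * E := by
  obtain ⟨k, hk⟩ := hYZ
  obtain ⟨l, hl⟩ := hrel
  constructor
  · rintro ⟨m, hm⟩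
    refine ⟨⟨B * m - s * D2 * k + s * Z * l, ?_⟩, ⟨- C * m - s * E * k + s * Y * l, ?_⟩⟩
    · linear_combination B * hm - s * D2 * hk + s * Z * hl
    · linear_combination -C * hm - s * E * hk + s * Y * hl
  · rintro ⟨⟨m, hm⟩, ⟨n, hn⟩⟩
    exact ⟨Y * m - Z * n, by linear_combination Y * hm - Z * hn⟩

lemma dvd_of_coprime_mul (r s x D : ℤ) (h : IsCoprime r s) (h1 : D ∣ r * x) (h2 : D ∣ s * x) :
    D ∣ x := by
  obtain ⟨a, b, hab⟩ := h
  obtain ⟨m, hm⟩ := h1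
  obtain ⟨n, hn⟩ := h2
  exact ⟨a * m + b * n, by linear_combination a * hm + b * hn - x * hab⟩

lemma dvd_aux (r1 r2 s1 s2 Y Z B C B2 C2 D1 D2 : ℤ) (hD1 : D1 ≠ 0)
    (hco : IsCoprime (r1 * r2) (s1 * s2))
    (hYZ : D1 ∣ Y * B + Z * C - 1) (hD : D1 * D2 ∣ D1 * C2 + B * B2 + D2 * C)
    (hr : D1 ∣ r1 * B) (hr2 : D2 ∣ r2 * B2) (hs : D1 ∣ s1 * D2) : D1 ∣ D2 := by
  have hB : D1 ∣ D2 * B := by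
    apply dvd_of_coprime_mul r1 s1 _ _ hco.of_mul_left_left.of_mul_right_left
    · exact (hr.mul_left D2).trans (by rw [mul_left_comm])
    · rw [← mul_assoc]
      exact hs.mul_right _
  have hC : D1 ∣ D2 * C := by
    apply dvd_of_coprime_mul (r1 * r2) (s1 * s2) _ _ hco
    · obtain ⟨k, hk⟩ := hD
      obtain ⟨l, hl⟩ := hr
      obtain ⟨m, hm⟩ := hr2
      exact ⟨r1 * r2 * (D2 * k - C2) - l * D2 * m,
        by linear_combination r1 * r2 * hk - r2 * B2 * hl - D1 * l * hm⟩
    · exact (hs.mul_right (s2 * C)).trans (dvd_of_eq (by ring))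
  obtain ⟨k, hk⟩ := hYZ
  obtain ⟨l, hl⟩ := hB
  obtain ⟨m, hm⟩ := hC
  exact ⟨Y * l + Z * m - D2 * k, by linear_combination Y * hl + Z * hm - D2 * hk⟩

lemma condF_iff (r1 s1 r2 s2 : ℤ) (D1 D2 : ℕ) (t : ℕ × ℕ × ℕ × ℕ) (hK : CondK D1 D2 t) :
    CondF r1 s1 r2 s2 D1 D2 t ↔ (D1 : ℤ) ∣ r1 * t.1 ∧ ((D1 : ℤ) ∣ s1 * D2 ∧ (D1 : ℤ) ∣ s1 * t.2.2.1)
      ∧ (D2 : ℤ) ∣ r2 * t.2.2.1 ∧ ((D2 : ℤ) ∣ s2 * D1 ∧ (D2 : ℤ) ∣ s2 * t.1) := by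
  obtain ⟨hd, hg1, hg2⟩ := hK
  have hd' : (D1 : ℤ) * D2 ∣ D1 * t.2.2.2 + t.1 * t.2.2.1 + D2 * t.2.1 := by exact_mod_cast hd
  obtain ⟨k, hk⟩ := hd'
  unfold CondF
  rw [cond_iff s1 _ _ _ _ _ _ _ (bezout_spec _ _ _ hg1) ⟨D2 * k - t.2.2.2, by linear_combination hk⟩,
    cond_iff s2 _ _ _ _ _ _ _ (bezout_spec _ _ _ hg2) ⟨D1 * k - t.2.1, by linear_combination hk⟩]

/-- Lemma 7(c) of Blomer–Buttcane: if `(r₁r₂, s₁s₂) = 1`, then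
`Ŝ_{r₁,s₁,r₂,s₂}(0, 0, 0, 0; D₁, D₂) = 0` unless `D₁ = D₂`, in which case it equals
`φ(D₁) = φ(D₂)`. -/
theorem statement5 (r1 s1 r2 s2 : ℤ) (hr1 : r1 ≠ 0) (hs1 : s1 ≠ 0) (hr2 : r2 ≠ 0)
    (hs2 : s2 ≠ 0) (hco : Int.gcd (r1 * r2) (s1 * s2) = 1)
    (D1 D2 : ℕ) (hD1 : 0 < D1) (hD2 : 0 < D2) :
    (D1 ≠ D2 → Shat r1 s1 r2 s2 0 0 0 0 D1 D2 = 0) ∧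
    (D1 = D2 → Shat r1 s1 r2 s2 0 0 0 0 D1 D2 = (Nat.totient D1 : ℂ)) := by
  classical
  have hcop : IsCoprime (r1 * r2) (s1 * s2) := Int.isCoprime_iff_gcd_eq_one.2 hco
  rw [Shat_eq_card r1 s1 r2 s2 D1 D2 hD1 hD2]
  constructor
  · intro hne
    rw [Nat.cast_eq_zero, Finset.card_eq_zero, Finset.filter_eq_empty_iff]
    rintro t - ⟨hK, hF⟩
    rw [condF_iff _ _ _ _ _ _ _ hK] at hF
    obtain ⟨a1, ⟨a2, a3⟩, a4, a5, a6⟩ := hF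
    obtain ⟨hd, hg1, hg2⟩ := hK
    have hd' : (D1 : ℤ) * D2 ∣ D1 * t.2.2.2 + t.1 * t.2.2.1 + D2 * t.2.1 := by exact_mod_cast hd
    have x1 := dvd_aux r1 r2 s1 s2 _ _ _ _ _ _ _ _ (by exact_mod_cast hD1.ne') hcop
      (bezout_spec _ _ _ hg1) hd' a1 a4 a2
    have x2 := dvd_aux r2 r1 s2 s1 _ _ t.2.2.1 t.2.2.2 t.1 t.2.1 D2 D1
      (by exact_mod_cast hD2.ne') (by rwa [mul_comm r2, mul_comm s2])
      (bezout_spec _ _ _ hg2) (by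
        rw [mul_comm (D2 : ℤ)]
        exact hd'.trans (dvd_of_eq (by ring))) a4 a1 a5
    exact hne (Nat.dvd_antisymm (by exact_mod_cast x1) (by exact_mod_cast x2))
  · rintro rfl
    congr 1
    rw [Nat.totient_eq_card_coprime]
    symm
    have hsum : ∀ C : ℕ, C < D1 → D1 ∣ C + (D1 - C) % D1 := by
      intro C hC
      rw [Nat.dvd_iff_mod_eq_zero, Nat.add_mod_mod, Nat.add_sub_cancel' hC.le, Nat.mod_self]
    have hcopr : ∀ C C' : ℕ, D1 ∣ C + C' → D1.Coprime C → D1.Coprime C' := by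
      intro C C' h hc
      have hg : Nat.gcd D1 C' ∣ C :=
        (Nat.dvd_add_left (Nat.gcd_dvd_right D1 C')).1 ((Nat.gcd_dvd_left D1 C').trans h)
      exact Nat.eq_one_of_dvd_coprimes hc (Nat.gcd_dvd_left D1 C') hg
    refine Finset.card_bij (fun C _ => (0, C, 0, (D1 - C) % D1)) ?_ ?_ ?_
    · intro C hC
      rw [Finset.mem_filter, Finset.mem_range] at hC
      have hK : CondK D1 D1 (0, C, 0, (D1 - C) % D1) := by
        refine ⟨?_, ?_, ?_⟩
        · simp only [zero_mul, add_zero, ← mul_add]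
          apply mul_dvd_mul_left
          rw [add_comm]
          exact hsum C hC.1
        · simpa [Nat.coprime_comm] using hC.2.symm
        · have := (hcopr _ _ (hsum C hC.1) hC.2).symm
          simpa using this
      rw [Finset.mem_filter]
      refine ⟨?_, hK, ?_⟩
      · simp [rng4, hC.1, hD1, Nat.mod_lt]
      · rw [condF_iff _ _ _ _ _ _ _ hK]
        simp
    · intro a _ b _ h
      simpa using (congrArg (fun t => t.2.1) h)
    · rintro ⟨B1, C1, B2, C2⟩ ht
      rw [Finset.mem_filter] at ht
      obtain ⟨hm, hK, hF⟩ := ht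
      rw [condF_iff _ _ _ _ _ _ _ hK] at hF
      obtain ⟨a1, ⟨a2, a3⟩, a4, a5, a6⟩ := hF
      obtain ⟨hd, hg1, hg2⟩ := hK
      simp only [rng4, Finset.mem_product, Finset.mem_range] at hm a1 a3 a4 a6 hd hg1 hg2
      obtain ⟨m1, m2, m3, m4⟩ := hm
      have z1 := dvd_of_coprime_mul r1 s2 _ _ hcop.of_mul_left_left.of_mul_right_right a1 a6
      have z2 := dvd_of_coprime_mul r2 s1 _ _ hcop.of_mul_left_right.of_mul_right_left a4 a3
      have z1' : B1 = 0 := Nat.eq_zero_of_dvd_of_lt (by exact_mod_cast z1) m1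
      have z2' : B2 = 0 := Nat.eq_zero_of_dvd_of_lt (by exact_mod_cast z2) m3
      subst z1' z2'
      rw [zero_mul, add_zero, ← mul_add] at hd
      have hd2 : D1 ∣ C2 + C1 := Nat.dvd_of_mul_dvd_mul_left hD1 hd
      refine ⟨C1, ?_, ?_⟩
      · rw [Finset.mem_filter, Finset.mem_range]
        refine ⟨m2, ?_⟩
        rw [Nat.gcd_zero_left] at hg1
        exact Nat.Coprime.symm hg1
      · have : (D1 - C1) % D1 = C2 := by
          have h := hsum C1 m2
          have hl := Nat.mod_lt (D1 - C1) hD1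
          have : (D1 - C1) % D1 ≡ C2 [MOD D1] := by
            apply Nat.ModEq.add_left_cancel' C1
            rw [add_comm C1 C2]
            exact ((Nat.modEq_zero_iff_dvd).2 h).trans ((Nat.modEq_zero_iff_dvd).2 hd2).symm
          exact Nat.ModEq.eq_of_lt_of_lt this hl m4
        rw [this]
end
end

section
/- For every integer d ≥ 2, every real c with (1−d)/2 < c < 0, and every real x > 0, one has J_{d−1}(2√x) = (1/(2π)) ∫_ℝ Q(d, c+it) · x^{−(c+it)} dt, the integral being absolutely convergent. -/
open MeasureTheory Finset Set
open scoped Real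

noncomputable section

/-- The Bessel function of the first kind:
`J_ν(x) = Σ_{k=0}^∞ ((−1)^k/(k! Γ(k+ν+1))) (x/2)^{2k+ν}`. -/
def besselJ (ν : ℝ) (x : ℝ) : ℝ :=
  ∑' k : ℕ, ((-1 : ℝ) ^ k / ((k.factorial : ℝ) * Real.Gamma ((k : ℝ) + ν + 1))) *
    (x / 2) ^ (2 * (k : ℝ) + ν)

/-- `Q(d,s) = Γ((d−1)/2 + s)/Γ((d+1)/2 − s)`. -/
def Qfun (d : ℕ) (s : ℂ) : ℂ :=
  Complex.Gamma (((d : ℂ) - 1) / 2 + s) / Complex.Gamma (((d : ℂ) + 1) / 2 - s)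


lemma circ (y : ℝ) (m : ℕ) : ∫ θ in (0:ℝ)..2*π, Complex.exp (y * Complex.exp (θ * Complex.I)) * Complex.exp (-(m * (θ * Complex.I))) = 2 * π * ((y:ℂ)^m / m.factorial) := by
  have h := (Differentiable.diffContOnCl (s := Metric.ball (0:ℂ) 1) (f := fun z : ℂ => Complex.exp (y * z)) (by fun_prop)).circleIntegral_one_div_sub_center_pow_smul one_pos m
  have hd : iteratedDeriv m (fun z : ℂ => Complex.exp (y * z)) 0 = y ^ m := by
    rw [iteratedDeriv_cexp_const_mul]; simp
  rw [hd, circleIntegral] at h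
  simp only [deriv_circleMap, sub_zero, circleMap_zero, smul_eq_mul, Complex.ofReal_one, one_mul] at h
  have e : ∀ θ : ℝ, Complex.exp (θ * Complex.I) * Complex.I * (1 / Complex.exp (θ * Complex.I) ^ (m + 1) * Complex.exp (y * Complex.exp (θ * Complex.I))) = Complex.I * (Complex.exp (y * Complex.exp (θ * Complex.I)) * Complex.exp (-(m * (θ * Complex.I)))) := by
    intro θ
    rw [Complex.exp_neg, Complex.exp_nat_mul]
    have := Complex.exp_ne_zero (θ * Complex.I)
    field_simp
    ring
  simp only [e] at h
  rw [intervalIntegral.integral_const_mul] at h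
  apply mul_left_cancel₀ Complex.I_ne_zero
  rw [h]; ring

noncomputable def BB (n : ℕ) (y : ℝ) : ℂ := (1 / (2 * π)) * ∫ θ in (0:ℝ)..2*π, Complex.exp (y * Complex.exp (θ * Complex.I)) * Complex.exp (-(n * (θ * Complex.I))) * Complex.exp (-(y * Complex.exp (-(θ * Complex.I))))

lemma BB_hasSum (n : ℕ) (y : ℝ) : HasSum (fun k : ℕ => (-1:ℂ)^k / (k.factorial * (k+n).factorial) * y^(2*k+n)) (BB n y) := by
  unfold BB
  have key : HasSum (fun k : ℕ => ∫ θ in (0:ℝ)..2*π, ((-y:ℂ)^k / k.factorial) * (Complex.exp (y * Complex.exp (θ * Complex.I)) * Complex.exp (-((k + n : ℕ) * (θ * Complex.I))))) (∫ θ in (0:ℝ)..2*π, Complex.exp (y * Complex.exp (θ * Complex.I)) * Complex.exp (-(n * (θ * Complex.I))) * Complex.exp (-(y * Complex.exp (-(θ * Complex.I))))) := by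
    apply intervalIntegral.hasSum_integral_of_dominated_convergence (fun k _ => |y|^k / k.factorial * Real.exp |y|)
    · intro k
      apply Continuous.aestronglyMeasurable
      fun_prop
    · intro k
      refine Filter.Eventually.of_forall fun θ _ => ?_
      have h1 : ‖Complex.exp (y * Complex.exp (θ * Complex.I))‖ ≤ Real.exp |y| := by
        refine (Complex.norm_exp_le_exp_norm _).trans ?_
        rw [norm_mul, Complex.norm_exp_ofReal_mul_I]; simp
      have h2 : ‖Complex.exp (-((k + n : ℕ) * (θ * Complex.I)))‖ = 1 := by
        rw [Complex.norm_exp]; simp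
      rw [norm_mul, norm_mul, h2, mul_one]
      simp only [norm_div, norm_pow, norm_neg, Complex.norm_real, Real.norm_eq_abs, RCLike.norm_natCast]
      gcongr
    · refine Filter.Eventually.of_forall fun θ _ => ?_
      exact (Real.summable_pow_div_factorial _).mul_right _
    · simp
    · refine Filter.Eventually.of_forall fun θ _ => ?_
      have := NormedSpace.expSeries_div_hasSum_exp (-(y * Complex.exp (-(θ * Complex.I)) : ℂ))
      rw [← Complex.exp_eq_exp_ℂ] at this
      convert! this.mul_left (Complex.exp (y * Complex.exp (θ * Complex.I)) * Complex.exp (-(n * (θ * Complex.I)))) using 2 with k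
      rw [← neg_mul (y:ℂ), mul_pow, ← Complex.exp_nat_mul]
      have : Complex.exp (-((k + n : ℕ) * (θ * Complex.I))) = Complex.exp (-(n * (θ * Complex.I))) * Complex.exp (k * (-(θ * Complex.I))) := by
        rw [← Complex.exp_add]; push_cast; ring_nf
      rw [this]; ring
  convert! key.mul_left (1 / (2 * π : ℂ)) using 2 with k
  rw [intervalIntegral.integral_const_mul, circ, neg_pow]
  have : (π : ℂ) ≠ 0 := by exact_mod_cast Real.pi_ne_zero
  have h1 : (k.factorial : ℂ) ≠ 0 := by exact_mod_cast k.factorial_ne_zero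
  have h2 : ((k+n).factorial : ℂ) ≠ 0 := by exact_mod_cast (k+n).factorial_ne_zero
  field_simp
  ring

lemma BB_cont (n : ℕ) : Continuous (BB n) := by
  unfold BB
  refine continuous_const.mul (intervalIntegral.continuous_parametric_intervalIntegral_of_continuous' ?_ _ _)
  unfold Function.uncurry
  fun_prop

lemma BB_le_one (n : ℕ) (y : ℝ) : ‖BB n y‖ ≤ 1 := by
  unfold BB
  have := intervalIntegral.norm_integral_le_of_norm_le_const (a := 0) (b := 2 * π) (C := 1) (f := fun θ : ℝ => Complex.exp (y * Complex.exp (θ * Complex.I)) * Complex.exp (-(n * (θ * Complex.I))) * Complex.exp (-(y * Complex.exp (-(θ * Complex.I))))) (by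
    intro θ _
    rw [← Complex.exp_add, ← Complex.exp_add, Complex.norm_exp]
    simp [Complex.exp_re])
  rw [norm_mul]
  simp only [sub_zero, one_mul] at this
  rw [abs_of_pos Real.two_pi_pos] at this
  calc _ ≤ ‖(1 / (2 * π) : ℂ)‖ * (2 * π) := by gcongr
    _ = 1 := by
      have := Real.pi_pos
      simp [abs_of_pos this]
      field_simp

lemma BB_le_pow (n : ℕ) (y : ℝ) (hy : 0 ≤ y) (hy1 : y ≤ 1) : ‖BB n y‖ ≤ Real.exp 1 * y ^ n := by
  have h := BB_hasSum n y
  have hs : HasSum (fun k : ℕ => (1:ℝ)^k / k.factorial * y^n) (Real.exp 1 * y ^ n) := by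
    have := NormedSpace.expSeries_div_hasSum_exp (1 : ℝ)
    rw [← Real.exp_eq_exp_ℝ] at this
    exact this.mul_right _
  rw [← h.tsum_eq]
  refine tsum_of_norm_bounded hs fun k => ?_
  simp only [norm_mul, norm_div, norm_pow, norm_neg, norm_one, one_pow, RCLike.norm_natCast, Complex.norm_real, Real.norm_eq_abs, abs_of_nonneg hy]
  rw [pow_add]
  have h1 : y ^ (2*k) ≤ 1 := pow_le_one₀ hy hy1
  have h2 : (1:ℝ) ≤ (k+n).factorial := by exact_mod_cast (k+n).factorial_pos
  have h3 : (0:ℝ) < k.factorial := by exact_mod_cast k.factorial_pos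
  have h4 : (1:ℝ) / (k.factorial * (k+n).factorial) ≤ 1 / k.factorial := by
    apply one_div_le_one_div_of_le h3; nlinarith
  calc _ ≤ 1 / (k.factorial:ℝ) * (1 * y ^ n) := by gcongr
    _ = _ := by ring

lemma pow_exp_int (p : ℝ) (hp : 0 < p) (m : ℕ) : ∫ x in Set.Ioi (0:ℝ), x ^ m * Real.exp (-(p * x)) = (1 / p) ^ (m + 1) * m.factorial := by
  have h := Real.integral_rpow_mul_exp_neg_mul_Ioi (a := m + 1) (r := p) (by positivity) hp
  rw [Real.Gamma_nat_eq_factorial] at h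
  simp only [add_sub_cancel_right, Real.rpow_natCast] at h
  rw [h]
  norm_cast

lemma pow_exp_integrable (p : ℝ) (hp : 0 < p) (m : ℕ) : IntegrableOn (fun x : ℝ => x ^ m * Real.exp (-(p * x))) (Set.Ioi 0) := by
  refine not_imp_comm.1 integral_undef ?_
  rw [pow_exp_int p hp]
  positivity

lemma laplace (n : ℕ) (p : ℝ) (hp : 0 < p) : ∫ x in Set.Ioi (0:ℝ), (√x : ℂ) ^ n * BB n √x * Complex.exp (-(p * x)) = (1 / p : ℂ) ^ (n + 1) * Complex.exp (-(1 / p)) := by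
  let F : ℕ → ℝ → ℂ := fun k x => ((-1:ℂ)^k / (k.factorial * (k+n).factorial)) * ((x ^ (k + n) * Real.exp (-(p * x)) : ℝ) : ℂ)
  have hFi : ∀ k, Integrable (F k) (volume.restrict (Set.Ioi 0)) := fun k =>
    ((pow_exp_integrable p hp (k + n)).ofReal).const_mul _
  have hn : ∀ k, ∫ x in Set.Ioi (0:ℝ), ‖F k x‖ = (1 / p) ^ k / k.factorial * (1 / p) ^ (n + 1) := by
    intro k
    have : ∀ x ∈ Set.Ioi (0:ℝ), ‖F k x‖ = (1 / (k.factorial * (k+n).factorial : ℝ)) * (x ^ (k + n) * Real.exp (-(p * x))) := by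
      intro x hx
      have hx : 0 < x := hx
      simp only [F, norm_mul, norm_div, norm_pow, norm_neg, norm_one, one_pow, RCLike.norm_natCast, Complex.norm_real]
      simp [abs_of_pos hx]
    rw [setIntegral_congr_fun measurableSet_Ioi this, integral_const_mul, pow_exp_int p hp]
    have h1 : (k.factorial : ℝ) ≠ 0 := by exact_mod_cast k.factorial_ne_zero
    have h2 : ((k+n).factorial : ℝ) ≠ 0 := by exact_mod_cast (k+n).factorial_ne_zero
    rw [show k + n + 1 = k + (n + 1) by ring, pow_add]
    field_simp
  have h := hasSum_integral_of_summable_integral_norm hFi (by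
    simp_rw [hn]
    exact (Real.summable_pow_div_factorial _).mul_right _)
  have hv : ∀ k, ∫ x in Set.Ioi (0:ℝ), F k x = (1 / p : ℂ) ^ (n + 1) * ((-(1 / p) : ℂ) ^ k / k.factorial) := by
    intro k
    simp only [F]
    rw [integral_const_mul, integral_complex_ofReal, pow_exp_int p hp]
    have h1 : (k.factorial : ℂ) ≠ 0 := by exact_mod_cast k.factorial_ne_zero
    have h2 : ((k+n).factorial : ℂ) ≠ 0 := by exact_mod_cast (k+n).factorial_ne_zero
    rw [neg_pow (1 / p : ℂ)]
    push_cast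
    rw [show k + n + 1 = k + (n + 1) by ring, pow_add]
    field_simp
  simp_rw [hv] at h
  have h' := (NormedSpace.expSeries_div_hasSum_exp (-(1 / p) : ℂ)).mul_left ((1 / p : ℂ) ^ (n + 1))
  rw [← Complex.exp_eq_exp_ℂ] at h'
  rw [← h.unique h']
  refine setIntegral_congr_fun measurableSet_Ioi fun x hx => ?_
  have hx : 0 < x := hx
  have hb := ((BB_hasSum n √x).mul_left ((√x : ℂ) ^ n)).mul_right (Complex.exp (-(p * x)))
  rw [← hb.tsum_eq]
  congr 1
  ext k
  simp only [F]
  have hq : (√x : ℂ) ^ 2 = x := by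
    rw [← Complex.ofReal_pow, Real.sq_sqrt hx.le]
  have : (√x : ℂ) ^ n * (√x : ℂ) ^ (2 * k + n) = (x:ℂ) ^ (k + n) := by
    rw [← hq]; ring
  push_cast
  rw [← this]
  ring

lemma sqrt_pow (n : ℕ) (x : ℝ) (hx : 0 < x) : (√x) ^ n = x ^ ((n : ℝ) / 2) := by
  rw [Real.sqrt_eq_rpow, ← Real.rpow_natCast, ← Real.rpow_mul hx.le]; congr 1; ring

lemma mellin_conv (n : ℕ) (s : ℂ) (h1 : -(n / 2 : ℝ) < s.re) (h2 : s.re < 0) : MellinConvergent (fun x => BB n √x) s := by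
  have hc : Continuous (fun x : ℝ => BB n √x) := (BB_cont n).comp Real.continuous_sqrt
  refine mellinConvergent_of_isBigO_rpow (a := 0) (b := -(n / 2 : ℝ)) (hc.locallyIntegrable.locallyIntegrableOn _) ?_ h2 ?_ h1
  · refine Asymptotics.IsBigO.of_bound 1 (Filter.Eventually.of_forall fun x => ?_)
    simpa using BB_le_one n √x
  · refine Asymptotics.IsBigO.of_bound (Real.exp 1) ?_
    filter_upwards [Ioo_mem_nhdsGT (zero_lt_one' ℝ)] with x hx
    rw [neg_neg, Real.norm_of_nonneg (Real.rpow_nonneg hx.1.le _), ← sqrt_pow n x hx.1]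
    exact BB_le_pow n √x (Real.sqrt_nonneg _) (by rw [Real.sqrt_le_left zero_le_one]; simpa using hx.2.le)

lemma mellin_BB (n : ℕ) (s : ℂ) (h1 : -(n / 2 : ℝ) < s.re) (h2 : s.re < 0) :
    mellin (fun x => BB n √x) s = Complex.Gamma (n / 2 + s) / Complex.Gamma (n / 2 + 1 - s) := by
  set a : ℂ := n / 2 + 1 - s with ha
  have hare : a.re = n / 2 + 1 - s.re := by
    have : ((n:ℂ) / 2).re = n / 2 := by
      rw [show ((n:ℂ) / 2) = ((n / 2 : ℝ) : ℂ) by push_cast; rfl, Complex.ofReal_re]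
    rw [ha, Complex.sub_re, Complex.add_re, this]; simp
  have hn0 : (0:ℝ) ≤ n / 2 := by positivity
  have ha0 : 0 < a.re := by rw [hare]; linarith
  have hconv := mellin_conv n s h1 h2
  have hc : Continuous (fun x : ℝ => BB n √x) := (BB_cont n).comp Real.continuous_sqrt
  let G : ℝ → ℝ → ℂ := fun x p => (√x : ℂ) ^ n * BB n √x * ((p:ℂ) ^ (a - 1) * Complex.exp (-(x * p)))
  have hGn : ∀ x ∈ Set.Ioi (0:ℝ), ∀ p ∈ Set.Ioi (0:ℝ), ‖G x p‖ = (√x ^ n * ‖BB n √x‖) * (p ^ (a.re - 1) * Real.exp (-(x * p))) := by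
    intro x hx p hp
    simp only [G, norm_mul, norm_pow, Complex.norm_real, Real.norm_of_nonneg (Real.sqrt_nonneg x)]
    rw [Complex.norm_cpow_eq_rpow_re_of_pos hp, Complex.norm_exp]
    simp
  have hrint : ∀ x ∈ Set.Ioi (0:ℝ), IntegrableOn (fun p : ℝ => p ^ (a.re - 1) * Real.exp (-(x * p))) (Set.Ioi 0) := by
    intro x hx
    have hx : 0 < x := hx
    refine not_imp_comm.1 integral_undef ?_
    rw [Real.integral_rpow_mul_exp_neg_mul_Ioi ha0 hx]
    have := Real.Gamma_pos_of_pos ha0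
    positivity
  have hmeas : AEStronglyMeasurable (Function.uncurry G) ((volume.restrict (Set.Ioi 0)).prod (volume.restrict (Set.Ioi 0))) := by
    apply Measurable.aestronglyMeasurable
    unfold Function.uncurry
    have hb : Measurable (BB n) := (BB_cont n).measurable
    have hb2 : Measurable (fun q : ℝ × ℝ => BB n √q.1) := hb.comp (Real.continuous_sqrt.measurable.comp measurable_fst)
    have hb3 : Measurable (fun q : ℝ × ℝ => (q.2:ℂ) ^ (a - 1)) := by fun_prop
    simp only [G]
    fun_prop
  have hGint : Integrable (Function.uncurry G) ((volume.restrict (Set.Ioi 0)).prod (volume.restrict (Set.Ioi 0))) := by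
    rw [integrable_prod_iff hmeas]
    constructor
    · filter_upwards [ae_restrict_mem measurableSet_Ioi] with x hx
      refine Integrable.mono' ((hrint x hx).const_mul (√x ^ n * ‖BB n √x‖)) ?_ ?_
      · apply Measurable.aestronglyMeasurable
        simp only [Function.uncurry, G]
        fun_prop
      · filter_upwards [ae_restrict_mem measurableSet_Ioi] with p hp
        exact (hGn x hx p hp).le
    · have := hconv.norm.mul_const (Real.Gamma a.re)
      refine this.congr ?_
      filter_upwards [ae_restrict_mem measurableSet_Ioi] with x hx
      have hx' : 0 < x := hx
      simp only [Function.uncurry]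
      rw [setIntegral_congr_fun measurableSet_Ioi (hGn x hx), integral_const_mul, Real.integral_rpow_mul_exp_neg_mul_Ioi ha0 hx', norm_smul, Complex.norm_cpow_eq_rpow_re_of_pos hx', sqrt_pow n x hx', one_div, Real.inv_rpow hx'.le, ← Real.rpow_neg hx'.le]
      have : x ^ (s - 1).re = x ^ ((n:ℝ) / 2) * x ^ (-a.re) := by
        rw [← Real.rpow_add hx', hare]; congr 1; simp; ring
      rw [this]; ring
  have hswap := integral_integral_swap hGint
  have hL : ∫ x in Set.Ioi (0:ℝ), ∫ p in Set.Ioi (0:ℝ), G x p = mellin (fun x => BB n √x) s * Complex.Gamma a := by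
    rw [mellin, ← integral_mul_const]
    refine setIntegral_congr_fun measurableSet_Ioi fun x hx => ?_
    have hx' : 0 < x := hx
    simp only [G]
    rw [integral_const_mul, Complex.integral_cpow_mul_exp_neg_mul_Ioi ha0 hx']
    have hxc : (x:ℂ) ≠ 0 := by exact_mod_cast hx'.ne'
    have e1 : (√x : ℂ) ^ n = (x:ℂ) ^ ((n:ℂ) / 2) := by
      rw [← Complex.ofReal_pow, sqrt_pow n x hx', Complex.ofReal_cpow hx'.le]; simp
    have e2 : (1 / (x:ℂ)) ^ a = (x:ℂ) ^ (-a) := by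
      rw [one_div, Complex.inv_cpow, Complex.cpow_neg]
      rw [Complex.arg_ofReal_of_nonneg hx'.le]; exact Real.pi_pos.ne
    have e3 : (x:ℂ) ^ (s - 1) = (x:ℂ) ^ ((n:ℂ) / 2) * (x:ℂ) ^ (-a) := by
      rw [← Complex.cpow_add _ _ hxc, ha]; congr 1; ring
    rw [e1, e2, smul_eq_mul, e3]; ring
  have hR : ∫ p in Set.Ioi (0:ℝ), ∫ x in Set.Ioi (0:ℝ), G x p = Complex.Gamma (n / 2 + s) := by
    have e0 : mellin (fun p : ℝ => Complex.exp (-(p:ℂ))) (n / 2 + s) = Complex.Gamma (n / 2 + s) := by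
      have := Complex.integral_cpow_mul_exp_neg_mul_Ioi (a := n / 2 + s) (r := 1) (by
        have : ((n:ℂ) / 2 + s).re = a.re - 1 + 2 * s.re := by
          rw [show (n:ℂ) / 2 + s = a - 1 + 2 * s by rw [ha]; ring]; simp
        rw [this, hare]; linarith) one_pos
      simpa [mellin] using this
    rw [← e0, ← neg_neg ((n:ℂ) / 2 + s), ← mellin_comp_inv, mellin]
    refine setIntegral_congr_fun measurableSet_Ioi fun p hp => ?_
    have hp' : 0 < p := hp
    have hpc : (p:ℂ) ≠ 0 := by exact_mod_cast hp'.ne'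
    have e1 : ∀ x : ℝ, G x p = (p:ℂ) ^ (a - 1) * ((√x : ℂ) ^ n * BB n √x * Complex.exp (-(p * x))) := by
      intro x; simp only [G]; rw [mul_comm (x:ℂ) p]; ring
    simp only [e1]
    rw [integral_const_mul, laplace n p hp', smul_eq_mul, ← mul_assoc]
    congr 1
    · rw [one_div, inv_pow, ← Complex.cpow_natCast, ← Complex.cpow_neg, ← Complex.cpow_add _ _ hpc, ha]
      congr 1; push_cast; ring
    · simp
  rw [eq_div_iff (Complex.Gamma_ne_zero_of_re_pos ha0), ← hL, hswap, hR]

/-- decreasing kernel for the beta integral -/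
noncomputable def bk (α β : ℝ) (v : ℝ) : ℝ := if 0 < v then Real.exp (-α * v) * (1 - Real.exp (-v)) ^ (β - 1) else 0

lemma bk_nonneg (α β v : ℝ) : 0 ≤ bk α β v := by
  unfold bk
  split_ifs with h
  · have : Real.exp (-v) ≤ 1 := by rw [Real.exp_le_one_iff]; linarith
    have : 0 ≤ 1 - Real.exp (-v) := by linarith
    positivity
  · rfl

lemma bk_anti (α β : ℝ) (hα : 1 ≤ α) (hβ1 : β ≤ 1) (v w : ℝ) (hv : 0 < v) (h : v ≤ w) : bk α β w ≤ bk α β v := by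
  have hw : 0 < w := by linarith
  unfold bk
  rw [if_pos hv, if_pos hw]
  have h0 : 0 < 1 - Real.exp (-v) := by
    have : Real.exp (-v) < 1 := by rw [Real.exp_lt_one_iff]; linarith
    linarith
  have h1 : Real.exp (-w) ≤ Real.exp (-v) := by gcongr
  apply mul_le_mul
  · apply Real.exp_le_exp.2; nlinarith
  · apply Real.rpow_le_rpow_of_nonpos h0 (by linarith) (by linarith)
  · have : 0 ≤ 1 - Real.exp (-w) := by linarith
    positivity
  · positivity

lemma bk_le (α β : ℝ) (hα : 1 ≤ α) (hβ : 0 < β) (hβ1 : β ≤ 1) (v : ℝ) (hv : 0 < v) : bk α β v ≤ v ^ (β - 1) := by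
  unfold bk
  rw [if_pos hv]
  have h0 : v * Real.exp (-v) ≤ 1 - Real.exp (-v) := by
    have h1 := Real.add_one_le_exp v
    have h2 : Real.exp v * Real.exp (-v) = 1 := by rw [← Real.exp_add]; simp
    have h3 := Real.exp_pos (-v)
    nlinarith
  have h1 : (1 - Real.exp (-v)) ^ (β - 1) ≤ (v * Real.exp (-v)) ^ (β - 1) :=
    Real.rpow_le_rpow_of_nonpos (by positivity) h0 (by linarith)
  rw [Real.mul_rpow hv.le (by positivity), ← Real.exp_mul] at h1
  calc _ ≤ Real.exp (-α * v) * (v ^ (β - 1) * Real.exp (-v * (β - 1))) := by gcongr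
    _ = v ^ (β - 1) * Real.exp (-α * v + -v * (β - 1)) := by rw [Real.exp_add]; ring
    _ ≤ v ^ (β - 1) * 1 := by
      gcongr
      rw [Real.exp_le_one_iff]; nlinarith [mul_pos hv hβ]
    _ = _ := by ring

lemma bk_meas (α β : ℝ) : Measurable (bk α β) := by
  unfold bk
  refine Measurable.ite (measurableSet_Ioi) ?_ measurable_const
  fun_prop

lemma bk_le_exp (α β : ℝ) (hα : 1 ≤ α) (hβ1 : β ≤ 1) (v : ℝ) (hv : 1 < v) :
   bk α β v ≤ (1 - Real.exp (-1)) ^ (β - 1) * Real.exp (-v) := by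
  have hv0 : 0 < v := by linarith
  unfold bk
  rw [if_pos hv0, mul_comm]
  have h0 : 0 < 1 - Real.exp (-1) := by
    have : Real.exp (-1) < 1 := by rw [Real.exp_lt_one_iff]; linarith
    linarith
  have h1 : Real.exp (-v) ≤ Real.exp (-1) := by gcongr
  gcongr ?_ * ?_
  · apply Real.rpow_le_rpow_of_nonpos h0 (by linarith) (by linarith)
  · apply Real.exp_le_exp.2; nlinarith

lemma bk_int (α β : ℝ) (hα : 1 ≤ α) (hβ : 0 < β) (hβ1 : β ≤ 1) : Integrable (bk α β) := by
  have hm := bk_meas α β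
  rw [← integrableOn_univ, show (Set.univ : Set ℝ) = Set.Iic 0 ∪ (Set.Ioc 0 1 ∪ Set.Ioi 1) by
    rw [Ioc_union_Ioi_eq_Ioi zero_le_one, Iic_union_Ioi]]
  refine IntegrableOn.union ?_ (IntegrableOn.union ?_ ?_)
  · refine (integrableOn_zero).congr_fun (fun v hv => ?_) measurableSet_Iic
    simp [bk, not_lt.2 (show v ≤ 0 from hv)]
  · have := (intervalIntegral.intervalIntegrable_rpow' (a := 0) (b := 1) (r := β - 1) (by linarith))
    rw [intervalIntegrable_iff_integrableOn_Ioc_of_le zero_le_one] at this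
    refine this.mono' hm.aestronglyMeasurable ?_
    filter_upwards [ae_restrict_mem measurableSet_Ioc] with v hv
    rw [Real.norm_of_nonneg (bk_nonneg _ _ _)]
    exact bk_le α β hα hβ hβ1 v hv.1
  · have := (integrableOn_exp_neg_Ioi 1).const_mul ((1 - Real.exp (-1)) ^ (β - 1))
    refine Integrable.mono' this hm.aestronglyMeasurable ?_
    filter_upwards [ae_restrict_mem measurableSet_Ioi] with v hv
    rw [Real.norm_of_nonneg (bk_nonneg _ _ _)]
    exact bk_le_exp α β hα hβ1 v hv

lemma bk_shift (α β : ℝ) (hα : 1 ≤ α) (hβ : 0 < β) (hβ1 : β ≤ 1) (h : ℝ) (hh : 0 < h) :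
    ∫ v, |bk α β v - bk α β (v + h)| ≤ 2 * (h ^ β / β) := by
  have hi := bk_int α β hα hβ hβ1
  have hi2 := hi.comp_add_right h
  have e : ∀ v, |bk α β v - bk α β (v + h)| = (bk α β v - bk α β (v + h)) + 2 * (Set.Iic 0).indicator (fun v => bk α β (v + h)) v := by
    intro v
    by_cases hv : v ≤ 0
    · have : bk α β v = 0 := by simp [bk, not_lt.2 hv]
      rw [this, indicator_of_mem (by exact hv), zero_sub, abs_neg, abs_of_nonneg (bk_nonneg _ _ _)]
      ring
    · push Not at hv
      rw [indicator_of_notMem (by simpa using hv), abs_of_nonneg]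
      · ring
      · linarith [bk_anti α β hα hβ1 v (v+h) hv (by linarith)]
  simp_rw [e]
  have hd : Integrable (fun v => bk α β v - bk α β (v + h)) := hi.sub hi2
  rw [integral_add hd ((hi2.indicator measurableSet_Iic).const_mul 2), integral_sub hi hi2, integral_add_right_eq_self (bk α β), sub_self, zero_add, integral_const_mul]
  gcongr
  have e2 : ∀ v, (Set.Iic 0).indicator (fun v => bk α β (v + h)) v = (Set.Iic h).indicator (bk α β) (v + h) := by
    intro v
    simp [indicator_apply]
  simp_rw [e2]
  rw [integral_add_right_eq_self ((Set.Iic h).indicator (bk α β))]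
  have hr := (intervalIntegral.intervalIntegrable_rpow' (a := 0) (b := h) (r := β - 1) (by linarith))
  rw [intervalIntegrable_iff_integrableOn_Ioc_of_le hh.le] at hr
  have : h ^ β / β = ∫ v, (Set.Ioc 0 h).indicator (fun v => v ^ (β - 1)) v := by
    rw [integral_indicator measurableSet_Ioc, ← intervalIntegral.integral_of_le hh.le, integral_rpow (Or.inl (by linarith))]
    simp [Real.zero_rpow hβ.ne']
  rw [this]
  refine integral_mono (hi.indicator measurableSet_Iic) ((integrable_indicator_iff measurableSet_Ioc).2 hr) fun v => ?_
  simp only [indicator_apply, Set.mem_Iic, Set.mem_Ioc]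
  by_cases h1 : v ≤ h
  · by_cases h2 : 0 < v
    · simp only [h1, h2, and_self, if_true]
      exact bk_le α β hα hβ hβ1 v h2
    · simp [h1, h2, bk]
  · simp [h1]

open Real FourierTransform in
lemma beta_bound (α β : ℝ) (hα : 1 ≤ α) (hβ : 0 < β) (hβ1 : β ≤ 1) (t : ℝ) (ht : 0 < t) :
    ‖Complex.betaIntegral (α + t * Complex.I) β‖ ≤ (π / t) ^ β / β := by
  have h1 : Complex.betaIntegral (α + t * Complex.I) β = mellin ((Set.Ioo 0 1).indicator (fun u : ℝ => (1 - (u:ℂ)) ^ ((β:ℂ) - 1))) (α + t * Complex.I) := by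
    rw [Complex.betaIntegral, mellin, intervalIntegral.integral_of_le zero_le_one, integral_Ioc_eq_integral_Ioo]
    rw [← integral_indicator measurableSet_Ioo, ← integral_indicator measurableSet_Ioi]
    congr 1
    ext u
    simp only [indicator_apply, Set.mem_Ioo, Set.mem_Ioi]
    by_cases h : 0 < u
    · by_cases h' : u < 1 <;> simp [h, h']
    · simp [h]
  have h2 : ∀ u : ℝ, (Real.exp (-((α + t * Complex.I : ℂ)).re * u) • ((Set.Ioo 0 1).indicator (fun u : ℝ => (1 - (u:ℂ)) ^ ((β:ℂ) - 1))) (Real.exp (-u))) = (bk α β u : ℂ) := by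
    intro u
    simp only [indicator_apply, Set.mem_Ioo, bk, Real.exp_pos, true_and, Real.exp_lt_one_iff, neg_lt_zero]
    by_cases h : 0 < u
    · have : 0 ≤ 1 - Real.exp (-u) := by
        have : Real.exp (-u) < 1 := by rw [Real.exp_lt_one_iff]; linarith
        linarith
      simp only [h, if_true]
      rw [Complex.ofReal_mul, Complex.ofReal_cpow this, Complex.real_smul]
      simp
    · simp [h]
  have h3 : t / (2 * π) ≠ 0 := by positivity
  rw [h1, mellin_eq_fourier]
  simp_rw [h2]
  have him : (α + t * Complex.I : ℂ).im = t := by simp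
  rw [him, Real.fourier_eq, fourierIntegral_eq_half_sub_half_period_translate h3 (bk_int α β hα hβ hβ1).ofReal, norm_smul]
  have hh : (1 / (2 * ‖t / (2 * π)‖ ^ 2)) • (t / (2 * π)) = π / t := by
    rw [Real.norm_of_nonneg (by positivity), smul_eq_mul]
    field_simp
  simp only [hh]
  calc _ ≤ ‖(1 / 2 : ℂ)‖ * ∫ v, |bk α β v - bk α β (v + π / t)| := by
        gcongr
        refine (norm_integral_le_integral_norm _).trans (le_of_eq ?_)
        congr 1
        ext v
        rw [Circle.norm_smul, ← Complex.ofReal_sub, Complex.norm_real, Real.norm_eq_abs]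
    _ ≤ ‖(1 / 2 : ℂ)‖ * (2 * ((π / t) ^ β / β)) := by
        gcongr
        exact bk_shift α β hα hβ hβ1 _ (by positivity)
    _ = _ := by norm_num; ring

lemma beta_bdd (α β : ℝ) (hα : 0 < α) (hβ : 0 ≤ β) : ∃ C : ℝ, ∀ t : ℝ, ‖Complex.Gamma (α + t * Complex.I) / Complex.Gamma (α + t * Complex.I + β)‖ ≤ C := by
  rcases hβ.eq_or_lt with rfl | hβ
  · refine ⟨1, fun t => ?_⟩
    simp only [Complex.ofReal_zero, add_zero]
    rw [norm_div]
    exact div_self_le_one _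
  refine ⟨(∫ x in (0:ℝ)..1, ‖(x:ℂ) ^ ((α:ℂ) - 1) * (1 - (x:ℂ)) ^ ((β:ℂ) - 1)‖) / ‖Complex.Gamma β‖, fun t => ?_⟩
  have hs : 0 < (α + t * Complex.I : ℂ).re := by simpa
  have h := Complex.Gamma_mul_Gamma_eq_betaIntegral hs (t := (β:ℂ)) (by simpa)
  have h1 : Complex.Gamma β ≠ 0 := Complex.Gamma_ne_zero_of_re_pos (by simpa)
  have h2 : Complex.Gamma (α + t * Complex.I + β) ≠ 0 := Complex.Gamma_ne_zero_of_re_pos (by simp; linarith)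
  have : Complex.Gamma (α + t * Complex.I) / Complex.Gamma (α + t * Complex.I + β) = Complex.betaIntegral (α + t * Complex.I) β / Complex.Gamma β := by
    rw [div_eq_div_iff h2 h1, h]; ring
  rw [this, norm_div]
  gcongr
  rw [Complex.betaIntegral]
  refine (intervalIntegral.norm_integral_le_integral_norm zero_le_one).trans (le_of_eq ?_)
  rw [intervalIntegral.integral_of_le zero_le_one, intervalIntegral.integral_of_le zero_le_one]
  refine setIntegral_congr_fun measurableSet_Ioc fun x hx => ?_
  simp only [norm_mul]
  congr 1
  rw [Complex.norm_cpow_eq_rpow_re_of_pos hx.1, Complex.norm_cpow_eq_rpow_re_of_pos hx.1]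
  simp

/-- decay of the Gamma quotient -/
lemma ratio_bound (a b : ℝ) (ha : 0 < a) (hab : a + 1 < b) : ∃ C ε : ℝ, 0 < ε ∧ ∀ t : ℝ, 0 < t →
    ‖Complex.Gamma (a + t * Complex.I) / Complex.Gamma (b + t * Complex.I)‖ ≤ C * t ^ (-1 - ε) := by
  set ε := min (b - a - 1) 1 with hε
  have hε0 : 0 < ε := lt_min (by linarith) one_pos
  have hε1 : ε ≤ 1 := min_le_right _ _
  have hε2 : ε ≤ b - a - 1 := min_le_left _ _
  obtain ⟨C, hC⟩ := beta_bdd (a + 1 + ε) (b - a - 1 - ε) (by linarith) (by linarith)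
  have hg : Complex.Gamma ε ≠ 0 := Complex.Gamma_ne_zero_of_re_pos (by simpa)
  refine ⟨π ^ ε / ε / ‖Complex.Gamma ε‖ * C, ε, hε0, fun t ht => ?_⟩
  set s : ℂ := a + t * Complex.I with hs
  have hsre : s.re = a := by simp [hs]
  have hs0 : s ≠ 0 := by intro h; rw [h] at hsre; simp at hsre; linarith
  have h1 : Complex.Gamma s = Complex.Gamma (s + 1) / s := by
    rw [Complex.Gamma_add_one _ hs0]; field_simp
  have hB := Complex.Gamma_mul_Gamma_eq_betaIntegral (s := s + 1) (t := (ε:ℂ)) (by simp [hsre]; linarith) (by simpa)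
  have h2 : Complex.Gamma (s + 1 + ε) ≠ 0 := Complex.Gamma_ne_zero_of_re_pos (by simp [hsre]; linarith)
  have h3 := hC t
  have e1 : ((a + 1 + ε : ℝ) : ℂ) + t * Complex.I = s + 1 + ε := by rw [hs]; push_cast; ring
  have e2 : s + 1 + ε + ((b - a - 1 - ε : ℝ) : ℂ) = b + t * Complex.I := by rw [hs]; push_cast; ring
  rw [e1, e2] at h3
  have h4 := beta_bound (a + 1) ε (by linarith) hε0 hε1 t ht
  have e3 : ((a + 1 : ℝ) : ℂ) + t * Complex.I = s + 1 := by rw [hs]; push_cast; ring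
  rw [e3] at h4
  have e4 : Complex.Gamma s / Complex.Gamma (b + t * Complex.I) = s⁻¹ * (Complex.betaIntegral (s + 1) ε / Complex.Gamma ε) * (Complex.Gamma (s + 1 + ε) / Complex.Gamma (b + t * Complex.I)) := by
    have : Complex.betaIntegral (s + 1) ε / Complex.Gamma ε = Complex.Gamma (s+1) / Complex.Gamma (s + 1 + ε) := by
      rw [div_eq_div_iff hg h2, hB]; ring
    rw [this, h1]
    field_simp
  have h5 : ‖s⁻¹‖ ≤ t⁻¹ := by
    rw [norm_inv]
    gcongr
    have := Complex.abs_im_le_norm s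
    simpa [hs, abs_of_pos ht] using this
  rw [e4, norm_mul, norm_mul, norm_div]
  calc _ ≤ t⁻¹ * (((π / t) ^ ε / ε) / ‖Complex.Gamma ε‖) * C := by gcongr
    _ = _ := by
      rw [Real.div_rpow Real.pi_pos.le ht.le, sub_eq_add_neg, Real.rpow_add ht, Real.rpow_neg ht.le, Real.rpow_neg ht.le, Real.rpow_one]
      ring

/-- The quotient of Gamma functions in the shifted notation, integrable on vertical lines. -/
lemma Q_integrable (n : ℕ) (c : ℝ) (h1 : -(n / 2 : ℝ) < c) (h2 : c < 0) :
    Integrable (fun t : ℝ => Complex.Gamma (n / 2 + ((c : ℂ) + (t : ℂ) * Complex.I)) /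
      Complex.Gamma (n / 2 + 1 - ((c : ℂ) + (t : ℂ) * Complex.I))) := by
  obtain ⟨C, ε, hε, hC⟩ := ratio_bound (n / 2 + c) (n / 2 + 1 - c) (by linarith) (by linarith)
  have e1 : ∀ t : ℝ, (n / 2 + ((c : ℂ) + (t : ℂ) * Complex.I)) = ((n / 2 + c : ℝ) : ℂ) + t * Complex.I := by
    intro t; push_cast; ring
  have e2 : ∀ t : ℝ, (n / 2 + 1 - ((c : ℂ) + (t : ℂ) * Complex.I)) = ((n / 2 + 1 - c : ℝ) : ℂ) - t * Complex.I := by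
    intro t; push_cast; ring
  have conj : ∀ (r t : ℝ), ‖Complex.Gamma (r - t * Complex.I)‖ = ‖Complex.Gamma (r + t * Complex.I)‖ := by
    intro r t
    have : (r - t * Complex.I : ℂ) = (starRingEnd ℂ) (r + t * Complex.I) := by
      simp [Complex.conj_ofReal, sub_eq_add_neg]
    rw [this, Complex.Gamma_conj, RCLike.norm_conj]
  simp_rw [e1, e2]
  refine LocallyIntegrable.integrable_of_isBigO_atTop_of_norm_isNegInvariant (g := fun t : ℝ => t ^ (-1 - ε)) ?_ ?_ ?_ ?_
  · apply Continuous.locallyIntegrable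
    rw [continuous_iff_continuousAt]
    intro t
    have g : ∀ z : ℂ, 0 < z.re → ContinuousAt Complex.Gamma z := by
      intro z hz
      refine (Complex.differentiableAt_Gamma z fun m h => ?_).continuousAt
      rw [h] at hz
      simp at hz
      have : (0:ℝ) ≤ m := by positivity
      linarith
    refine ContinuousAt.div ?_ ?_ ?_
    · exact ContinuousAt.comp (f := fun t : ℝ => (((n / 2 + c : ℝ) : ℂ) + t * Complex.I)) (g _ (by simp; linarith)) (by fun_prop)
    · exact ContinuousAt.comp (f := fun t : ℝ => (((n / 2 + 1 - c : ℝ) : ℂ) - t * Complex.I)) (g _ (by simp; linarith)) (by fun_prop)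
    · exact Complex.Gamma_ne_zero_of_re_pos (by simp; linarith)
  · refine Filter.Eventually.of_forall fun t => ?_
    simp only [Function.comp_apply, norm_div, conj]
    rw [Complex.ofReal_neg, neg_mul, ← sub_eq_add_neg, ← sub_eq_add_neg, conj, conj]
  · refine Asymptotics.IsBigO.of_bound C ?_
    filter_upwards [Filter.eventually_gt_atTop 0] with t ht
    rw [norm_div, conj, ← norm_div, Real.norm_of_nonneg (Real.rpow_nonneg ht.le _)]
    exact hC t ht
  · rw [integrableAtFilter_rpow_atTop_iff]; linarith

lemma bessel_eq (n : ℕ) (x : ℝ) (hx : 0 < x) : ((besselJ (n : ℝ) (2 * Real.sqrt x) : ℝ) : ℂ) = BB n √x := by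
  rw [besselJ, ← (BB_hasSum n √x).tsum_eq, Complex.ofReal_tsum]
  congr 1
  ext k
  have h1 : (2 * √x / 2) ^ (2 * (k:ℝ) + n) = √x ^ (2 * k + n) := by
    rw [mul_div_cancel_left₀ _ two_ne_zero, ← Real.rpow_natCast]; push_cast; rfl
  have h2 : Real.Gamma ((k:ℝ) + n + 1) = (k + n).factorial := by
    rw [← Real.Gamma_nat_eq_factorial]; push_cast; rfl
  rw [h1, h2]
  push_cast
  rfl

/-- Mellin formula for the Bessel function: for `d ≥ 2`,
`(1−d)/2 < c < 0` and `x > 0`, `J_{d−1}(2√x) = (1/2π) ∫_ℝ Q(d, c+it) x^{−(c+it)} dt`,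
the integral being absolutely convergent. -/
theorem statement8 (d : ℕ) (hd : 2 ≤ d) (c : ℝ) (hc1 : (1 - (d : ℝ)) / 2 < c)
    (hc2 : c < 0) (x : ℝ) (hx : 0 < x) :
    Integrable (fun t : ℝ =>
        Qfun d ((c : ℂ) + (t : ℂ) * Complex.I) *
          (x : ℂ) ^ (-((c : ℂ) + (t : ℂ) * Complex.I))) ∧
    (besselJ ((d : ℝ) - 1) (2 * Real.sqrt x) : ℂ) =
      (1 / (2 * (Real.pi : ℂ))) *
        ∫ t : ℝ, Qfun d ((c : ℂ) + (t : ℂ) * Complex.I) *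
          (x : ℂ) ^ (-((c : ℂ) + (t : ℂ) * Complex.I)) := by
  obtain ⟨n, rfl⟩ : ∃ n, d = n + 1 := ⟨d - 1, by omega⟩
  push_cast at hc1
  have hc1' : -(n / 2 : ℝ) < c := by linarith
  have hQ : ∀ s : ℂ, Qfun (n + 1) s = Complex.Gamma (n / 2 + s) / Complex.Gamma (n / 2 + 1 - s) := by
    intro s
    unfold Qfun
    push_cast
    congr 2 <;> ring
  have hM : ∀ t : ℝ, mellin (fun x => BB n √x) ((c : ℂ) + (t : ℂ) * Complex.I) = Qfun (n + 1) ((c : ℂ) + (t : ℂ) * Complex.I) := by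
    intro t
    rw [hQ, mellin_BB n _ (by simpa using hc1') (by simpa using hc2)]
  have hI : Integrable (fun t : ℝ => Qfun (n + 1) ((c : ℂ) + (t : ℂ) * Complex.I)) := by
    simp_rw [hQ]
    exact Q_integrable n c hc1' hc2
  constructor
  · refine hI.mul_bdd (c := x ^ (-c)) ?_ ?_
    · apply Continuous.aestronglyMeasurable
      have : (x:ℂ) ≠ 0 := by exact_mod_cast hx.ne'
      exact Continuous.const_cpow (by fun_prop) (Or.inl this)
    · refine Filter.Eventually.of_forall fun t => ?_
      rw [Complex.norm_cpow_eq_rpow_re_of_pos hx]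
      simp
  · have hinv := mellinInv_mellin_eq c (fun x => BB n √x) hx (mellin_conv n c (by simpa using hc1') (by simpa using hc2)) (by
      unfold Complex.VerticalIntegrable
      simp_rw [hM]
      exact hI) ((BB_cont n).comp Real.continuous_sqrt).continuousAt
    have e : (((n + 1 : ℕ) : ℝ) - 1) = n := by push_cast; ring
    rw [e, bessel_eq n x hx, ← hinv, mellinInv]
    simp_rw [hM]
    rw [Complex.real_smul]
    push_cast
    congr 2
    ext t
    rw [smul_eq_mul, mul_comm]
end
end

section
/- Let d ≥ 2 be an integer, r purely imaginary, y ∈ ℝ∖{0} and ε := sgn(y). Then K_{w4}(y; d, r) = 2·(εi)^d · |y|^{1−r} · π^{1−3r} · ∫_0^∞ J_{d−1}(2√x) · exp(2εi·4π³|y|/x) · (4π³|y|/x)^{3r} · dx/x, the integral on the right converging absolutely. -/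
open MeasureTheory Finset Set
open scoped Real

noncomputable section

/-- The `w₄` Bessel kernel `K_{w₄}(y; d, r)`, written as an integral over the vertical
line `Re s = 1/12` (a fixed choice of `σ ∈ (0, 1/6)`; the value is independent of this
choice): `K_{w₄}(y;d,r) = ((εi)^d/4π²) ∫ |8π³y|^{1−r−s} Q(d,s) Γ(s+3r) e^{εiπ(s+3r)/2}
ds/(2πi)` with `ε = sgn y`. -/
def Kw4 (y : ℝ) (d : ℕ) (r : ℂ) : ℂ :=
  (((Real.sign y : ℂ) * Complex.I) ^ d / (4 * (Real.pi : ℂ) ^ 2)) *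
    (1 / (2 * (Real.pi : ℂ))) *
    ∫ t : ℝ,
      ((|8 * Real.pi ^ 3 * y| : ℝ) : ℂ) ^
          ((1 : ℂ) - r - ((1 / 12 : ℂ) + (t : ℂ) * Complex.I)) *
        Qfun d ((1 / 12 : ℂ) + (t : ℂ) * Complex.I) *
        Complex.Gamma ((1 / 12 : ℂ) + (t : ℂ) * Complex.I + 3 * r) *
        Complex.exp ((Real.sign y : ℂ) * Complex.I * (Real.pi : ℂ) *
          ((1 / 12 : ℂ) + (t : ℂ) * Complex.I + 3 * r) / 2)


def xxc (n k : ℕ) : ℝ := (-1 : ℝ)^k / ((k.factorial : ℝ) * ((k+n).factorial : ℝ))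
def xxF (n : ℕ) (x : ℝ) : ℝ := ∑' k : ℕ, xxc n k * x^k

lemma xxc_abs (n k : ℕ) : |xxc n k| ≤ 1 / (k.factorial : ℝ) := by
  unfold xxc
  rw [abs_div, abs_pow, abs_neg, abs_one, one_pow, abs_of_pos (by positivity)]
  apply one_div_le_one_div_of_le (by positivity)
  have : (1:ℝ) ≤ ((k+n).factorial : ℝ) := by exact_mod_cast Nat.one_le_iff_ne_zero.2 (Nat.factorial_ne_zero _)
  nlinarith [show (0:ℝ) < k.factorial by positivity]

lemma xxF_term (n k : ℕ) (x : ℝ) : ‖xxc n k * x^k‖ ≤ |x|^k / (k.factorial : ℝ) := by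
  rw [norm_mul, norm_pow, Real.norm_eq_abs, Real.norm_eq_abs, div_eq_mul_one_div, mul_comm]
  gcongr
  exact xxc_abs n k

lemma xxF_summable (n : ℕ) (x : ℝ) : Summable (fun k => xxc n k * x^k) :=
  Summable.of_norm_bounded (Real.summable_pow_div_factorial |x|) fun k => xxF_term n k x

lemma xxF_bound (n : ℕ) (x : ℝ) : |xxF n x| ≤ Real.exp |x| := by
  have h : HasSum (fun k : ℕ => |x|^k / (k.factorial : ℝ)) (Real.exp |x|) := by
    rw [Real.exp_eq_exp_ℝ]; exact NormedSpace.expSeries_div_hasSum_exp |x|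
  exact tsum_of_norm_bounded h fun k => xxF_term n k x

lemma xxc_succ (n k : ℕ) : xxc n (k+1) * (k+1) = - xxc (n+1) k := by
  unfold xxc
  rw [show k + 1 + n = k + (n+1) by ring, Nat.factorial_succ k]
  push_cast
  have : ((k + (n+1)).factorial : ℝ) ≠ 0 := by positivity
  field_simp
  ring

lemma xxF_deriv (n : ℕ) (x : ℝ) : HasDerivAt (xxF n) (- xxF (n+1) x) x := by
  have hu : Summable (fun k : ℕ => k * ((|x|+1)^(k-1) / (k.factorial : ℝ))) := by
    rw [← summable_nat_add_iff 1]
    refine (Real.summable_pow_div_factorial (|x|+1)).congr fun k => ?_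
    rw [Nat.factorial_succ]; push_cast
    field_simp
  have h := hasDerivAt_tsum_of_isPreconnected (u := fun k : ℕ => k * ((|x|+1)^(k-1) / (k.factorial : ℝ)))
    (g := fun k y => xxc n k * y^k) (g' := fun k y => xxc n k * (k * y^(k-1)))
    (t := Metric.ball (0:ℝ) (|x|+1)) (y₀ := x) (y := x) hu Metric.isOpen_ball
    (convex_ball _ _).isPreconnected
    (fun k y _ => (hasDerivAt_pow k y).const_mul _) (fun k y hy => by
      rw [norm_mul, norm_mul, norm_pow, Real.norm_eq_abs, Real.norm_eq_abs, Real.norm_eq_abs]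
      have hy' : |y| ≤ |x|+1 := by
        have := Metric.mem_ball.1 hy
        rw [dist_zero_right, Real.norm_eq_abs] at this; exact this.le
      calc _ ≤ (1 / (k.factorial : ℝ)) * (k * (|x|+1)^(k-1)) := by
            rw [Nat.abs_cast]
            gcongr
            exact xxc_abs n k
        _ = _ := by ring)
    (by simp) (xxF_summable n x) (by simp)
  refine HasDerivAt.congr_deriv h ?_
  have hs : Summable (fun k : ℕ => xxc n k * (k * x^(k-1))) := by
    rw [← summable_nat_add_iff 1]
    refine (xxF_summable (n+1) x).neg.congr fun k => ?_
    push_cast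
    rw [← mul_assoc, xxc_succ]; ring
  rw [hs.tsum_eq_zero_add]
  simp only [Nat.cast_zero, zero_mul, mul_zero, zero_add]
  unfold xxF
  rw [← tsum_neg]
  refine tsum_congr fun k => ?_
  push_cast
  rw [← mul_assoc, xxc_succ]; ring

lemma xxF_rec (n : ℕ) (x : ℝ) : xxF n x = (n+1) * xxF (n+1) x - x * xxF (n+2) x := by
  unfold xxF
  rw [(xxF_summable n x).tsum_eq_zero_add, (xxF_summable (n+1) x).tsum_eq_zero_add, ← tsum_mul_left,
    mul_add, ← tsum_mul_left, add_sub_assoc, ← (((summable_nat_add_iff 1).2 (xxF_summable (n+1) x)).mul_left _).tsum_sub ((xxF_summable (n+2) x).mul_left x)]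
  congr 1
  · simp only [xxc, Nat.zero_add, Nat.factorial_succ]; push_cast
    have : (n.factorial : ℝ) ≠ 0 := by positivity
    field_simp
  · refine tsum_congr fun k => ?_
    have h := xxc_succ (n+1) k
    have : xxc n (k+1) = (n + 1) * xxc (n+1) (k+1) + (k+1) * xxc (n+1) (k+1) := by
      unfold xxc
      rw [show k+1+(n+1) = (k+1+n)+1 by ring, Nat.factorial_succ (k+1+n)]
      push_cast
      have : ((k+1+n).factorial : ℝ) ≠ 0 := by positivity
      field_simp
      ring
    rw [this]
    have : xxc (n+2) k = - (xxc (n+1) (k+1) * (k+1)) := by rw [h]; ring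
    rw [this]; ring

/-- j(v) = J_n(2 v) -/
def xxj (n : ℕ) (v : ℝ) : ℝ := v^n * xxF n (v^2)
def xxk (n : ℕ) (v : ℝ) : ℝ := (n/2:ℝ) * v^n * xxF n (v^2) - v^(n+2) * xxF (n+1) (v^2)

lemma xxF_deriv2 (n : ℕ) (v : ℝ) : HasDerivAt (fun v => xxF n (v^2)) (-xxF (n+1) (v^2) * (2 * v)) v := by
  have := (xxF_deriv n (v^2)).comp v (hasDerivAt_pow 2 v)
  refine HasDerivAt.congr_deriv this ?_
  simp

lemma xxpow (n : ℕ) (v : ℝ) (hv : v ≠ 0) : HasDerivAt (fun v : ℝ => v^n) (n * v^n / v) v := by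
  refine HasDerivAt.congr_deriv (hasDerivAt_pow n v) ?_
  cases n with
  | zero => simp
  | succ m => simp only [Nat.add_sub_cancel, pow_succ]; field_simp

lemma xxj_deriv (n : ℕ) (v : ℝ) (hv : 0 < v) : HasDerivAt (xxj n) (2 * xxk n v / v) v := by
  have := (xxpow n v hv.ne').mul (xxF_deriv2 n v)
  refine HasDerivAt.congr_deriv this ?_
  unfold xxk
  field_simp
  ring

lemma xxk_deriv (n : ℕ) (v : ℝ) (hv : 0 < v) :
    HasDerivAt (xxk n) (2 * ((n:ℝ)^2/4 - v^2) * xxj n v / v) v := by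
  have := (((xxpow n v hv.ne').const_mul (n/2:ℝ)).mul (xxF_deriv2 n v)).sub
    ((xxpow (n+2) v hv.ne').mul (xxF_deriv2 (n+1) v))
  refine HasDerivAt.congr_deriv this ?_
  unfold xxj
  have h := xxF_rec n (v^2)
  have h2 : v^2 * xxF (n+2) (v^2) = (n+1) * xxF (n+1) (v^2) - xxF n (v^2) := by linarith
  have e : v^(n+2) * (-xxF (n+1+1) (v^2) * (2*v)) = - v^n * 2 * v * (v^2 * xxF (n+2) (v^2)) := by ring
  rw [e, h2]
  push_cast
  field_simp
  ring

lemma xx_energy (c : ℝ) (hc : 0 ≤ c) (j k : ℝ → ℝ) (hj : ∀ v, 0 < v → HasDerivAt j (2 * k v / v) v)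
    (hk : ∀ v, 0 < v → HasDerivAt k (2 * (c - v^2) * j v / v) v) :
    ∃ C, ∀ v, 1 ≤ v → v * (j v)^2 ≤ C := by
  set H : ℝ → ℝ := fun v => (k v)^2 / v + v * (j v)^2 + j v * k v / (2 * v) with hH
  have lower : ∀ v, 1 ≤ v → (3/4) * ((k v)^2 / v + v * (j v)^2) ≤ H v := by
    intro v hv
    have hv0 : 0 < v := by linarith
    have : H v - (3/4) * ((k v)^2 / v + v * (j v)^2) = ((k v + j v)^2 + (v^2-1) * (j v)^2) / (4 * v) := by
      simp only [hH]; field_simp; ring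
    have h2 : 0 ≤ ((k v + j v)^2 + (v^2-1) * (j v)^2) / (4 * v) := by
      have : 0 ≤ v^2 - 1 := by nlinarith
      positivity
    linarith
  have hHd : ∀ v, 0 < v → HasDerivAt H ((4*c-1/2) * (j v * k v) / v^2 + c * (j v)^2/v^2) v := by
    intro v hv
    have := ((((hk v hv).pow 2).div (hasDerivAt_id v) hv.ne').add ((hasDerivAt_id v).mul ((hj v hv).pow 2))).add
      (((hj v hv).mul (hk v hv)).div ((hasDerivAt_id v).const_mul 2) (by simp [hv.ne']))
    refine HasDerivAt.congr_deriv this ?_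
    simp only [id, Pi.mul_apply, Pi.pow_apply]
    field_simp
    ring
  set M : ℝ := 4/3 * ((4*c+1/2)/2 + c) with hM
  have hE : ∀ v, 0 < v → HasDerivAt (fun v => Real.exp (M / v)) (Real.exp (M/v) * (-M / v^2)) v := by
    intro v hv
    have := ((hasDerivAt_inv hv.ne').const_mul M).exp
    refine HasDerivAt.congr_deriv this ?_
    simp only [div_eq_mul_inv]; ring
  have anti : AntitoneOn (fun v => H v * Real.exp (M / v)) (Set.Ici 1) := by
    have hd : ∀ v, 0 < v → HasDerivAt (fun v => H v * Real.exp (M / v)) _ v := fun v hv => (hHd v hv).mul (hE v hv)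
    refine antitoneOn_of_deriv_nonpos (convex_Ici 1) ?_ ?_ ?_
    · intro v hv
      exact (hd v (lt_of_lt_of_le one_pos hv)).continuousAt.continuousWithinAt
    · intro v hv
      rw [interior_Ici] at hv
      exact (hd v (lt_trans one_pos hv)).differentiableAt.differentiableWithinAt
    · intro v hv
      rw [interior_Ici] at hv
      have hv1 : 1 < v := hv
      have hv0 : 0 < v := lt_trans one_pos hv1
      rw [(hd v hv0).deriv]
      have l := lower v hv1.le
      set S := (k v)^2 / v + v * (j v)^2 with hS
      have b1 : |j v * k v| ≤ S/2 := by
        have : S * v = (k v)^2 + (v * j v)^2 := by rw [hS]; field_simp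
        rw [abs_le]
        constructor
        · nlinarith [sq_nonneg (k v + v * j v)]
        · nlinarith [sq_nonneg (k v - v * j v)]
      have b2 : (j v)^2 ≤ S := by
        have : 0 ≤ (k v)^2 / v := by positivity
        nlinarith [sq_nonneg (j v)]
      have b3 : (4*c-1/2) * (j v * k v) ≤ (4*c+1/2) * (S/2) := by
        calc _ ≤ |(4*c-1/2) * (j v * k v)| := le_abs_self _
          _ = |4*c-1/2| * |j v * k v| := abs_mul _ _
          _ ≤ _ := by
            gcongr
            rw [abs_le]; constructor <;> linarith
      have b4 : (4*c-1/2) * (j v * k v) + c * (j v)^2 ≤ M * H v := by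
        calc _ ≤ (4*c+1/2) * (S/2) + c * S := by gcongr
          _ = M * (3/4 * S) := by rw [hM]; ring
          _ ≤ _ := by gcongr
      have : ((4*c-1/2) * (j v * k v) / v^2 + c * (j v)^2/v^2) * Real.exp (M / v) + H v * (Real.exp (M/v) * (-M / v^2))
        = Real.exp (M/v) / v^2 * (((4*c-1/2) * (j v * k v) + c * (j v)^2) - M * H v) := by
        field_simp
        ring
      rw [this]
      exact mul_nonpos_of_nonneg_of_nonpos (by positivity) (by linarith)
  have hM0 : 0 ≤ M := by positivity
  refine ⟨4/3 * (H 1 * Real.exp (M/1)), fun v hv => ?_⟩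
  have hv0 : 0 < v := by linarith
  have a := anti (Set.mem_Ici.2 le_rfl) (Set.mem_Ici.2 hv) hv
  simp only at a
  have l := lower v hv
  have e1 : 1 ≤ Real.exp (M / v) := Real.one_le_exp (by positivity)
  have s0 : 0 ≤ (k v)^2 / v := by positivity
  have s1 : 0 ≤ v * (j v)^2 := by positivity
  have : H v ≤ H v * Real.exp (M / v) := by nlinarith
  linarith

lemma xxj_decay (n : ℕ) : ∃ C, 0 ≤ C ∧ ∀ v, 1 ≤ v → |xxj n v| ≤ C * v^(-(1/2):ℝ) := by
  obtain ⟨C, hC⟩ := xx_energy ((n:ℝ)^2/4) (by positivity) (xxj n) (xxk n) (xxj_deriv n) (xxk_deriv n)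
  refine ⟨√C, by positivity, fun v hv => ?_⟩
  have hv0 : 0 < v := by linarith
  have h := hC v hv
  rw [Real.rpow_neg hv0.le, ← Real.sqrt_eq_rpow, ← div_eq_mul_inv, le_div_iff₀ (by positivity)]
  apply Real.le_sqrt_of_sq_le
  rw [mul_pow, Real.sq_sqrt hv0.le, sq_abs]
  linarith

lemma xxj_small (n : ℕ) (hn : 1 ≤ n) (v : ℝ) (h0 : 0 ≤ v) (h1 : v ≤ 1) : |xxj n v| ≤ Real.exp 1 * v := by
  unfold xxj
  rw [abs_mul, abs_of_nonneg (by positivity), mul_comm]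
  have a : v^n ≤ v := pow_le_of_le_one h0 h1 (by omega)
  have b := xxF_bound n (v^2)
  have : |v^2| ≤ 1 := by rw [abs_of_nonneg (by positivity)]; exact pow_le_one₀ h0 h1
  have := Real.exp_le_exp.2 this
  gcongr
  linarith

lemma xx_bessel (n : ℕ) (x : ℝ) (hx : 0 < x) : besselJ (((n+1:ℕ):ℝ) - 1) (2 * √x) = xxj n √x := by
  unfold besselJ xxj xxF
  rw [← tsum_mul_left]
  refine tsum_congr fun k => ?_
  have hs : 0 < √x := by positivity
  rw [mul_div_cancel_left₀ _ (by norm_num : (2:ℝ) ≠ 0)]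
  have e1 : 2 * (k:ℝ) + (((n+1:ℕ):ℝ) - 1) = ((2 * k + n : ℕ) : ℝ) := by push_cast; ring
  have e2 : (k:ℝ) + (((n+1:ℕ):ℝ) - 1) + 1 = ((k + n : ℕ) : ℝ) + 1 := by push_cast; ring
  rw [e1, e2, Real.Gamma_nat_eq_factorial, Real.rpow_natCast, xxc, pow_add, pow_mul]
  ring


lemma xx_conv (t u v θ : ℝ) (hu : 0 < u) (hv : 0 < v) (h0 : 0 ≤ θ) (h1 : θ ≤ 1) :
    1 + t^2 / ((1-θ)*u+θ*v)^2 ≤ (1 + t^2/u^2)^(1-θ) * (1+t^2/v^2)^θ := by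
  have hg : u^(1-θ) * v^θ ≤ (1-θ)*u+θ*v :=
    Real.geom_mean_le_arith_mean2_weighted (by linarith) h0 hu.le hv.le (by ring)
  have hgp : 0 < u^(1-θ) * v^θ := by positivity
  set a := 1 + t^2/u^2 with ha
  set b := 1 + t^2/v^2 with hb
  have hap : 0 < a := by positivity
  have hbp : 0 < b := by positivity
  have e1 : (1/a)^(1-θ) * (1/b)^θ ≤ (1-θ)*(1/a) + θ*(1/b) :=
    Real.geom_mean_le_arith_mean2_weighted (by linarith) h0 (by positivity) (by positivity) (by ring)
  have e2 : ((t^2/u^2)/a)^(1-θ) * ((t^2/v^2)/b)^θ ≤ (1-θ)*((t^2/u^2)/a) + θ*((t^2/v^2)/b) :=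
    Real.geom_mean_le_arith_mean2_weighted (by linarith) h0 (by positivity) (by positivity) (by ring)
  have ea : 1/a + (t^2/u^2)/a = 1 := by rw [← add_div, ← ha, div_self hap.ne']
  have eb : 1/b + (t^2/v^2)/b = 1 := by rw [← add_div, ← hb, div_self hbp.ne']
  have e3 : (1/a)^(1-θ) * (1/b)^θ + ((t^2/u^2)/a)^(1-θ) * ((t^2/v^2)/b)^θ ≤ 1 := by
    calc _ ≤ (1-θ)*(1/a + (t^2/u^2)/a) + θ*(1/b + (t^2/v^2)/b) := by linarith
      _ = 1 := by rw [ea, eb]; ring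
  rw [Real.div_rpow (by positivity) hap.le, Real.div_rpow (by positivity) hbp.le,
    Real.div_rpow (by positivity) hap.le, Real.div_rpow (by positivity) hbp.le,
    Real.div_rpow (by positivity) (by positivity), Real.div_rpow (by positivity) (by positivity),
    Real.one_rpow, Real.one_rpow] at e3
  have hA : 0 < a^(1-θ) := by positivity
  have hB : 0 < b^θ := by positivity
  have ht : (t^2)^(1-θ) * (t^2)^θ = t^2 := by
    rcases eq_or_ne t 0 with rfl | h
    · rcases eq_or_ne θ 0 with rfl | h'
      · simp
      · simp [Real.zero_rpow h']
    · rw [← Real.rpow_add (by positivity)]; simp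
  have hu2 : (u^2)^(1-θ) = (u^(1-θ))^2 := by
    rw [← Real.rpow_natCast, ← Real.rpow_natCast, ← Real.rpow_mul hu.le, ← Real.rpow_mul hu.le, mul_comm]
  have hv2 : (v^2)^(θ) = (v^(θ))^2 := by
    rw [← Real.rpow_natCast, ← Real.rpow_natCast, ← Real.rpow_mul hv.le, ← Real.rpow_mul hv.le, mul_comm]
  rw [hu2, hv2] at e3
  have e4 : 1 + t^2/(u^(1-θ) * v^θ)^2 ≤ a^(1-θ) * b^θ := by
    have : 1 / a ^ (1 - θ) * (1 / b ^ θ) +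
      (t ^ 2) ^ (1 - θ) / (u ^ (1 - θ)) ^ 2 / a ^ (1 - θ) * ((t ^ 2) ^ θ / (v ^ θ) ^ 2 / b ^ θ)
      = (1 + t^2/(u^(1-θ) * v^θ)^2) / (a^(1-θ) * b^θ) := by
      rw [← ht]
      have := Real.rpow_pos_of_pos hu (1-θ)
      have := Real.rpow_pos_of_pos hv (θ)
      simp only [ht]
      generalize (t^2)^(1-θ) = p at *
      generalize (t^2)^(θ) = q at *
      rw [← ht]
      field_simp
    rw [this, div_le_one (by positivity)] at e3
    exact e3
  refine le_trans ?_ e4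
  gcongr

lemma xx_norm (t u : ℝ) (hu : 0 < u) :
    (‖(u : ℂ) + t * Complex.I‖ / u) = (1 + t^2/u^2)^((1:ℝ)/2) := by
  rw [← Real.sqrt_eq_rpow, Complex.norm_add_mul_I]
  rw [eq_comm, Real.sqrt_eq_iff_mul_self_eq (by positivity) (by positivity)]
  rw [div_mul_div_comm, Real.mul_self_sqrt (by positivity)]
  field_simp

lemma xx_conv2 (t u v θ : ℝ) (hu : 0 < u) (hv : 0 < v) (h0 : 0 ≤ θ) (h1 : θ ≤ 1) :
    ‖(((1-θ)*u+θ*v : ℝ) : ℂ) + t * Complex.I‖ / ((1-θ)*u+θ*v) ≤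
      (‖(u : ℂ) + t * Complex.I‖ / u)^(1-θ) * (‖(v : ℂ) + t * Complex.I‖ / v)^θ := by
  have hp : 0 < (1-θ)*u+θ*v := by
    rcases eq_or_lt_of_le h0 with rfl | h
    · simpa
    · nlinarith [mul_pos h hv, mul_nonneg (sub_nonneg.2 h1) hu.le]
  rw [xx_norm _ _ hu, xx_norm _ _ hv, xx_norm _ _ hp, ← Real.rpow_mul (by positivity),
    ← Real.rpow_mul (by positivity), mul_comm (1/2) (1-θ), mul_comm (1/2) θ, Real.rpow_mul (by positivity),
    Real.rpow_mul (by positivity), ← Real.mul_rpow (by positivity) (by positivity)]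
  apply Real.rpow_le_rpow (by positivity) _ (by norm_num)
  exact xx_conv t u v θ hu hv h0 h1

lemma xx_seq (x t : ℝ) (hx : 0 < x) (N : ℕ) (hN : N ≠ 0):
    ‖Complex.GammaSeq x N‖ / ‖Complex.GammaSeq (x + t * Complex.I) N‖ =
      ∏ j ∈ range (N+1), (‖((x + j : ℝ) : ℂ) + t * Complex.I‖ / (x + j)) := by
  unfold Complex.GammaSeq
  rw [norm_div, norm_div, norm_mul, norm_mul, Complex.norm_natCast_cpow_of_pos (by omega),
    Complex.norm_natCast_cpow_of_pos (by omega), Finset.prod_div_distrib, norm_prod, norm_prod]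
  have : ∏ b ∈ range (N+1), ‖(x:ℂ) + b‖ = ∏ b ∈ range (N+1), (x + b) := by
    refine Finset.prod_congr rfl fun j _ => ?_
    rw [← Complex.ofReal_natCast, ← Complex.ofReal_add, Complex.norm_of_nonneg (by positivity)]
  rw [this]
  have h2 : ∏ b ∈ range (N+1), ‖(x:ℂ) + t * Complex.I + b‖ = ∏ b ∈ range (N+1), ‖((x + b : ℝ) : ℂ) + t * Complex.I‖ := by
    refine Finset.prod_congr rfl fun j _ => ?_
    congr 1; push_cast; ring
  rw [h2]
  have h3 : (x + t * Complex.I).re = x := by simp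
  rw [h3, Complex.ofReal_re]
  have p1 : 0 < ∏ b ∈ range (N+1), (x + b) := Finset.prod_pos fun j _ => by positivity
  have p2 : (N:ℝ)^x ≠ 0 := by positivity
  have p3 : ‖(N.factorial : ℂ)‖ ≠ 0 := by simp [Nat.factorial_ne_zero]
  field_simp

/-- key Gamma inequality -/
lemma xx_gamma (x t θ : ℝ) (hx : 0 < x) (h0 : 0 ≤ θ) (h1 : θ ≤ 1) :
    ‖Complex.Gamma (x + t * Complex.I)‖ ≤ Real.Gamma x / Real.Gamma (x+θ) *
      (‖(x:ℂ) + t * Complex.I‖ / x)^(-θ) * ‖Complex.Gamma ((x + θ : ℝ) + t * Complex.I)‖ := by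
  have key : ∀ z : ℝ, 0 < z → Filter.Tendsto (fun N => ‖Complex.GammaSeq z N‖ / ‖Complex.GammaSeq (z + t * Complex.I) N‖) Filter.atTop (nhds (Real.Gamma z / ‖Complex.Gamma (z + t * Complex.I)‖)) := by
    intro z hz
    have a1 := (Complex.GammaSeq_tendsto_Gamma z).norm
    have a2 := (Complex.GammaSeq_tendsto_Gamma (z + t * Complex.I)).norm
    rw [Complex.Gamma_ofReal, Complex.norm_of_nonneg (Real.Gamma_pos_of_pos hz).le] at a1
    refine a1.div a2 ?_
    rw [norm_ne_zero_iff]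
    apply Complex.Gamma_ne_zero_of_re_pos
    simpa
  have gp : ∀ z : ℝ, 0 < z → 0 < ‖Complex.Gamma (z + t * Complex.I)‖ := by
    intro z hz
    rw [norm_pos_iff]
    apply Complex.Gamma_ne_zero_of_re_pos
    simpa
  have hle := le_of_tendsto_of_tendsto (key (x+θ) (by positivity))
    (((key x hx).rpow_const (p := 1-θ) (Or.inr (by linarith))).mul
     ((key (x+1) (by positivity)).rpow_const (p := θ) (Or.inr h0))) (by
      filter_upwards [Filter.eventually_ne_atTop 0] with N hN
      rw [xx_seq _ _ (by positivity) _ hN, xx_seq _ _ (by positivity) _ hN, xx_seq _ _ (by positivity) _ hN,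
        ← Real.finsetProd_rpow _ _ (fun i _ => by positivity),
        ← Real.finsetProd_rpow _ _ (fun i _ => by positivity), ← Finset.prod_mul_distrib]
      refine Finset.prod_le_prod (fun i _ => by positivity) fun i _ => ?_
      have := xx_conv2 t (x+i) (x+1+i) θ (by positivity) (by positivity) h0 h1
      rwa [show (1-θ)*(x+i)+θ*(x+1+i) = x + θ + i by ring] at this)
  have hne : (x:ℂ) + t * Complex.I ≠ 0 := by
    intro h; have := congrArg Complex.re h; simp at this; exact hx.ne' this
  have e1 : Complex.Gamma ((x+1:ℝ) + t * Complex.I) = (x + t * Complex.I) * Complex.Gamma (x + t * Complex.I) := by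
    rw [← Complex.Gamma_add_one _ hne]; congr 1; push_cast; ring
  rw [e1, norm_mul, Real.Gamma_add_one hx.ne'] at hle
  have g0 := gp x hx
  have gθ := gp (x+θ) (by positivity)
  have G0 := Real.Gamma_pos_of_pos hx
  have Gθ := Real.Gamma_pos_of_pos (show 0 < x+θ by positivity)
  have nn : 0 < ‖(x:ℂ) + t * Complex.I‖ := norm_pos_iff.2 hne
  rw [mul_div_mul_comm, Real.mul_rpow (by positivity) (by positivity), mul_left_comm,
    ← Real.rpow_add (by positivity), sub_add_cancel, Real.rpow_one] at hle
  have e2 : (x / ‖(x:ℂ) + t * Complex.I‖)^θ = (‖(x:ℂ) + t * Complex.I‖ / x)^(-θ) := by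
    rw [Real.rpow_neg (by positivity), ← Real.inv_rpow (by positivity), inv_div]
  rw [e2] at hle
  rw [div_le_iff₀ gθ] at hle
  generalize (‖(x:ℂ) + t * Complex.I‖ / x)^(-θ) = w at *
  rw [div_mul_eq_mul_div, div_mul_eq_mul_div, le_div_iff₀ Gθ]
  calc _ ≤ ‖Complex.Gamma (x + t * Complex.I)‖ * (w * (Real.Gamma x / ‖Complex.Gamma (↑x + ↑t * Complex.I)‖) * ‖Complex.Gamma (↑(x + θ) + ↑t * Complex.I)‖) := by gcongr
    _ = _ := by field_simp

lemma xx_half (t : ℝ) : ‖Complex.Gamma ((1/2:ℝ) + t * Complex.I)‖ ≤ √(2 * π) * Real.exp (-(π/2 * |t|)) := by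
  have h := Complex.Gamma_mul_Gamma_one_sub ((1/2:ℝ) + t * Complex.I)
  have e : (1 : ℂ) - ((1/2:ℝ) + t * Complex.I) = (starRingEnd ℂ) ((1/2:ℝ) + t * Complex.I) := by
    apply Complex.ext <;> simp; norm_num
  rw [e, Complex.Gamma_conj, Complex.mul_conj] at h
  have e2 : Complex.sin (π * ((1/2:ℝ) + t * Complex.I)) = (Real.cosh (π * t) : ℝ) := by
    rw [show (π:ℂ) * ((1/2:ℝ) + t * Complex.I) = (π * t) * Complex.I + π/2 by push_cast; ring,
      Complex.sin_add_pi_div_two, Complex.cos_mul_I]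
    push_cast; rfl
  rw [e2, ← Complex.ofReal_div, Complex.ofReal_inj, Complex.normSq_eq_norm_sq] at h
  have h3 : ‖Complex.Gamma ((1/2:ℝ) + t * Complex.I)‖^2 ≤ (√(2 * π) * Real.exp (-(π/2 * |t|)))^2 := by
    rw [h, mul_pow, Real.sq_sqrt (by positivity), ← Real.exp_nat_mul, div_le_iff₀ (Real.cosh_pos _)]
    have : Real.exp (π * |t|) ≤ 2 * Real.cosh (π * t) := by
      rw [← Real.cosh_abs, abs_mul, abs_of_pos Real.pi_pos, Real.cosh_eq]
      have := Real.exp_pos (-(π * |t|)); linarith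
    calc π = π * (Real.exp (-(π * |t|)) * Real.exp (π * |t|)) := by rw [← Real.exp_add]; simp
      _ ≤ π * (Real.exp (-(π * |t|)) * (2 * Real.cosh (π * t))) := by gcongr
      _ = _ := by
        rw [show ((2:ℕ):ℝ) * -(π/2*|t|) = -(π * |t|) by push_cast; ring]; ring
  exact le_of_sq_le_sq h3 (by positivity)


lemma xx_expint (σ b : ℝ) (hσ : 0 < σ) (hb : 0 < b) :
    IntegrableOn (fun u : ℝ => u^(σ-1) * Real.exp (-(b * u))) (Ioi 0) := by
  have := integrableOn_rpow_mul_exp_neg_mul_rpow (p := 1) (s := σ-1) (b := b) (by linarith) one_pos hb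
  simpa [neg_mul] using this

lemma xx_cint_norm (w z : ℂ) (u : ℝ) (hu : 0 < u) :
    ‖(u:ℂ)^(w-1) * Complex.exp (-(z * u))‖ = u^(w.re-1) * Real.exp (-(z.re * u)) := by
  rw [norm_mul, Complex.norm_cpow_eq_rpow_re_of_pos hu, Complex.norm_exp]
  simp

lemma xx_cint_meas (w z : ℂ) : AEStronglyMeasurable (fun u : ℝ => (u:ℂ)^(w-1) * Complex.exp (-(z * u)))
    (volume.restrict (Ioi 0)) := by
  apply Measurable.aestronglyMeasurable
  fun_prop

lemma xx_cint (w z : ℂ) (hw : 0 < w.re) (hz : 0 < z.re) :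
    IntegrableOn (fun u : ℝ => (u:ℂ)^(w-1) * Complex.exp (-(z * u))) (Ioi 0) := by
  refine (xx_expint w.re z.re hw hz).mono' (xx_cint_meas w z) ?_
  filter_upwards [ae_restrict_mem measurableSet_Ioi] with u hu
  rw [xx_cint_norm w z u hu]

lemma xx_cderiv (w z : ℂ) (hw : 0 < w.re) (hz : 0 < z.re) :
    DifferentiableAt ℂ (fun z : ℂ => ∫ u in Ioi (0:ℝ), (u:ℂ)^(w-1) * Complex.exp (-(z * u))) z := by
  have h := hasDerivAt_integral_of_dominated_loc_of_deriv_le (μ := volume.restrict (Ioi (0:ℝ)))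
    (F := fun (z:ℂ) (u:ℝ) => (u:ℂ)^(w-1) * Complex.exp (-(z * u)))
    (F' := fun (z:ℂ) (u:ℝ) => (u:ℂ)^(w-1) * (Complex.exp (-(z * u)) * (-u)))
    (x₀ := z) (s := Metric.ball z (z.re/2))
    (bound := fun u => u^((w.re+1)-1) * Real.exp (-((z.re/2) * u)))
    (Metric.ball_mem_nhds _ (by positivity))
    (Filter.Eventually.of_forall fun z => xx_cint_meas w z) (xx_cint w z hw hz)
    (by apply Measurable.aestronglyMeasurable; fun_prop)
    (by
      filter_upwards [ae_restrict_mem measurableSet_Ioi] with u hu x hx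
      have hu : 0 < u := hu
      rw [← mul_assoc, norm_mul, xx_cint_norm w x u hu, norm_neg, Complex.norm_of_nonneg hu.le]
      rw [show w.re + 1 - 1 = (w.re - 1) + 1 by ring, Real.rpow_add hu, Real.rpow_one, mul_right_comm]
      have h1 : z.re/2 ≤ x.re := by
        have h2 := Metric.mem_ball.1 hx
        rw [dist_eq_norm] at h2
        have h3 := Complex.abs_re_le_norm (x - z)
        rw [Complex.sub_re] at h3
        have := neg_abs_le (x.re - z.re)
        linarith
      gcongr)
    (xx_expint _ _ (by linarith) (by positivity))
    (by
      filter_upwards [ae_restrict_mem measurableSet_Ioi] with u hu x hx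
      have : HasDerivAt (fun z : ℂ => -(z * u)) (-u) x := HasDerivAt.congr_deriv ((hasDerivAt_id x).mul_const (u:ℂ)).neg (by simp)
      exact (this.cexp).const_mul _)
  exact h.2.differentiableAt

lemma xx_cgamma (w z : ℂ) (hw : 0 < w.re) (hz : 0 < z.re) :
    ∫ u in Ioi (0:ℝ), (u:ℂ)^(w-1) * Complex.exp (-(z * u)) = z^(-w) * Complex.Gamma w := by
  set U : Set ℂ := {z | 0 < z.re} with hU
  have hUo : IsOpen U := isOpen_lt continuous_const Complex.continuous_re
  have hUc : IsPreconnected U := (convex_halfSpace_re_gt 0).isPreconnected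
  have a1 : AnalyticOnNhd ℂ (fun z : ℂ => ∫ u in Ioi (0:ℝ), (u:ℂ)^(w-1) * Complex.exp (-(z * u))) U := by
    apply DifferentiableOn.analyticOnNhd _ hUo
    intro z hz
    exact (xx_cderiv w z hw hz).differentiableWithinAt
  have a2 : AnalyticOnNhd ℂ (fun z : ℂ => z^(-w) * Complex.Gamma w) U := by
    apply DifferentiableOn.analyticOnNhd _ hUo
    intro z hz
    have : z ∈ Complex.slitPlane := Or.inl hz
    exact ((differentiableAt_id.cpow_const this).mul_const _).differentiableWithinAt
  have key := a1.eqOn_of_preconnected_of_frequently_eq a2 hUc (z₀ := 1) (by simp [hU]) ?_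
  · exact key hz
  · have ht : Filter.Tendsto (fun n : ℕ => (((1 : ℝ) + 1/((n:ℝ)+1) : ℝ) : ℂ)) Filter.atTop (nhdsWithin 1 {1}ᶜ) := by
      apply tendsto_nhdsWithin_iff.2
      constructor
      · have := (tendsto_one_div_add_atTop_nhds_zero_nat (𝕜 := ℝ)).const_add 1
        rw [add_zero] at this
        have := (Complex.continuous_ofReal.tendsto 1).comp this
        rw [Complex.ofReal_one] at this
        exact this
      · refine Filter.Eventually.of_forall fun n => ?_
        simp only [Set.mem_compl_iff, Set.mem_singleton_iff, Complex.ofReal_eq_one]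
        have : (0:ℝ) < 1/((n:ℝ)+1) := by positivity
        linarith
    refine ht.frequently (Filter.Frequently.of_forall fun n => ?_)
    have hp : (0:ℝ) < 1 + 1/((n:ℝ)+1) := by positivity
    generalize (1:ℝ) + 1/((n:ℝ)+1) = q at hp
    have := Complex.integral_cpow_mul_exp_neg_mul_Ioi hw hp
    rw [this, one_div, Complex.inv_cpow _ _ (by rw [Complex.arg_ofReal_of_nonneg hp.le]; exact Real.pi_pos.ne), Complex.cpow_neg]

lemma xxF_cont (n : ℕ) : Continuous (xxF n) :=
  continuous_iff_continuousAt.2 fun x => (xxF_deriv n x).continuousAt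

lemma xxj_cont (n : ℕ) : Continuous (fun x : ℝ => xxj n √x) := by
  unfold xxj
  have := xxF_cont n
  fun_prop

lemma xxj_int (n : ℕ) (hn : 1 ≤ n) (σ : ℝ) (h0 : 0 ≤ σ) (h1 : σ < 1/4) :
    IntegrableOn (fun x : ℝ => |xxj n √x| * x^(σ-1)) (Ioi 0) := by
  have hm : Measurable (fun x : ℝ => |xxj n √x| * x^(σ-1)) := by
    have := (xxj_cont n).measurable
    fun_prop
  rw [← Ioc_union_Ioi_eq_Ioi (zero_le_one' ℝ)]
  refine IntegrableOn.union ?_ ?_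
  · have := (intervalIntegral.intervalIntegrable_rpow' (a := 0) (b := 1) (r := σ - 1/2) (by linarith)).1
    refine Integrable.mono' (this.const_mul (Real.exp 1)) hm.aestronglyMeasurable ?_
    filter_upwards [ae_restrict_mem measurableSet_Ioc] with x hx
    rw [Real.norm_eq_abs, abs_of_nonneg (mul_nonneg (abs_nonneg _) (Real.rpow_nonneg hx.1.le _))]
    have := xxj_small n hn √x (by positivity) (Real.sqrt_le_one.2 hx.2)
    calc _ ≤ Real.exp 1 * √x * x^(σ-1) := by
          have := Real.rpow_nonneg hx.1.le (σ-1)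
          gcongr
      _ = _ := by
        rw [mul_assoc, Real.sqrt_eq_rpow, ← Real.rpow_add hx.1]; congr 2; ring
  · obtain ⟨C, hC0, hC⟩ := xxj_decay n
    have := integrableOn_Ioi_rpow_of_lt (a := σ - 5/4) (c := 1) (by linarith) one_pos
    refine Integrable.mono' (this.const_mul C) hm.aestronglyMeasurable ?_
    filter_upwards [ae_restrict_mem measurableSet_Ioi] with x hx
    have hx1 : 1 < x := hx
    have hx0 : 0 < x := by linarith
    rw [Real.norm_eq_abs, abs_of_nonneg (by positivity)]
    have := hC √x (Real.one_le_sqrt.2 hx1.le)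
    calc _ ≤ C * √x^(-(1/2):ℝ) * x^(σ-1) := by gcongr
      _ = _ := by
        rw [mul_assoc, Real.sqrt_eq_rpow, ← Real.rpow_mul hx0.le, ← Real.rpow_add hx0]; congr 2; ring

lemma xx_laplace (n : ℕ) (p : ℝ) (hp : 0 < p) :
    ∫ x in Ioi (0:ℝ), xxj n √x * √x^n * Real.exp (-(p * x)) = (1/p)^(n+1) * Real.exp (-(1/p)) := by
  have e0 : ∀ k : ℕ, ∀ x : ℝ, 0 < x → x^(((n+k+1:ℕ):ℝ)-1) = x^(n+k) := by
    intro k x hx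
    rw [← Real.rpow_natCast]; congr 1; push_cast; ring
  have i0 : ∀ k : ℕ, ∫ x in Ioi (0:ℝ), x^(n+k) * Real.exp (-(p*x)) = (1/p)^(n+k+1) * ((n+k).factorial : ℝ) := by
    intro k
    have := Real.integral_rpow_mul_exp_neg_mul_Ioi (a := ((n+k+1:ℕ):ℝ)) (r := p) (by positivity) hp
    rw [Real.rpow_natCast, Nat.cast_add_one, Real.Gamma_nat_eq_factorial] at this
    rw [← this]
    refine setIntegral_congr_fun measurableSet_Ioi fun x hx => ?_
    have := e0 k x hx
    push_cast at this ⊢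
    simp only [this]
  have i1 : ∀ k : ℕ, IntegrableOn (fun x : ℝ => x^(n+k) * Real.exp (-(p*x))) (Ioi 0) := by
    intro k
    refine (xx_expint ((n+k+1:ℕ):ℝ) p (by positivity) hp).congr_fun (fun x hx => ?_) measurableSet_Ioi
    simp only [e0 k x hx]
  have hc : ∀ k, |xxc n k| * ((1/p)^(n+k+1) * ((n+k).factorial : ℝ)) = (1/p)^(n+1) * ((1/p)^k / k.factorial) := by
    intro k
    unfold xxc
    rw [abs_div, abs_pow, abs_neg, abs_one, one_pow, abs_of_pos (by positivity), add_comm k n]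
    have : ((n+k).factorial : ℝ) ≠ 0 := by positivity
    rw [show n + k + 1 = (n+1) + k by ring, pow_add]
    field_simp
  have hc' : ∀ k, xxc n k * ((1/p)^(n+k+1) * ((n+k).factorial : ℝ)) = (1/p)^(n+1) * ((-(1/p))^k / k.factorial) := by
    intro k
    unfold xxc
    rw [add_comm k n]
    have : ((n+k).factorial : ℝ) ≠ 0 := by positivity
    rw [show n + k + 1 = (n+1) + k by ring, pow_add, neg_eq_neg_one_mul (1/p), mul_pow]
    field_simp
  have hs := hasSum_integral_of_summable_integral_norm (μ := volume.restrict (Ioi (0:ℝ)))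
    (F := fun (k:ℕ) (x:ℝ) => xxc n k * (x^(n+k) * Real.exp (-(p*x)))) (fun k => (i1 k).const_mul _)
    (by
      have : ∀ k : ℕ, ∫ x in Ioi (0:ℝ), ‖xxc n k * (x^(n+k) * Real.exp (-(p*x)))‖ = (1/p)^(n+1) * ((1/p)^k / k.factorial) := by
        intro k
        rw [← hc k, ← i0 k, ← integral_const_mul]
        refine setIntegral_congr_fun measurableSet_Ioi fun x hx => ?_
        have hx : 0 < x := hx
        simp only [norm_mul, Real.norm_eq_abs]
        rw [abs_of_nonneg (a := x^(n+k)) (by positivity), abs_of_nonneg (a := Real.exp _) (by positivity)]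
      simp_rw [this]
      exact (Real.summable_pow_div_factorial (1/p)).mul_left _)
  have hs2 : HasSum (fun k : ℕ => ∫ x in Ioi (0:ℝ), xxc n k * (x^(n+k) * Real.exp (-(p*x)))) ((1/p)^(n+1) * Real.exp (-(1/p))) := by
    simp_rw [integral_const_mul, i0, hc']
    apply HasSum.mul_left
    rw [Real.exp_eq_exp_ℝ]; exact NormedSpace.expSeries_div_hasSum_exp _
  rw [← hs.unique hs2]
  refine setIntegral_congr_fun measurableSet_Ioi fun x hx => ?_
  have hx : 0 < x := hx
  simp only [xxj, xxF]
  rw [Real.sq_sqrt hx.le, mul_right_comm (√x^n), ← mul_pow, Real.mul_self_sqrt hx.le, ← tsum_mul_left, ← tsum_mul_right]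
  refine tsum_congr fun k => ?_
  rw [pow_add]; ring


lemma xx_mellinJ (n : ℕ) (hn : 1 ≤ n) (s : ℂ) (h0 : 0 ≤ s.re) (h1 : s.re < 1/4) :
    ∫ x in Ioi (0:ℝ), (xxj n √x : ℂ) * (x:ℂ)^(s-1) =
      Complex.Gamma ((n:ℂ)/2 + s) / Complex.Gamma ((n:ℂ)/2 + 1 - s) := by
  set a : ℂ := (n:ℂ)/2 + 1 - s with ha
  have har : a.re = (n:ℝ)/2 + 1 - s.re := by
    rw [ha]; simp
  have ha0 : 0 < a.re := by rw [har]; have : (0:ℝ) ≤ n := by positivity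
                            linarith
  have hb0 : 0 < ((n:ℂ)/2 + s).re := by
    have : (1:ℝ) ≤ n := by exact_mod_cast hn
    simp; linarith
  have hG : Complex.Gamma a ≠ 0 := Complex.Gamma_ne_zero_of_re_pos ha0
  set f : ℝ → ℝ → ℂ := fun x p => ((xxj n √x * √x^n : ℝ) : ℂ) * ((p:ℂ)^(a-1) * Complex.exp (-((x:ℂ) * p))) with hf
  have hfm : Measurable (Function.uncurry f) := by
    have : Measurable (fun p : ℝ × ℝ => xxj n √p.1) := (xxj_cont n).measurable.comp measurable_fst
    simp only [hf, Function.uncurry_def]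
    fun_prop
  have hsq : ∀ x : ℝ, 0 < x → √x^n = x^((n:ℝ)/2) := by
    intro x hx
    rw [Real.sqrt_eq_rpow, ← Real.rpow_natCast, ← Real.rpow_mul hx.le]; congr 1; ring
  have hnorm : ∀ x : ℝ, 0 < x → ∫ p in Ioi (0:ℝ), ‖f x p‖ = Real.Gamma a.re * (|xxj n √x| * x^(s.re-1)) := by
    intro x hx
    have : ∫ p in Ioi (0:ℝ), ‖f x p‖ = ∫ p in Ioi (0:ℝ), (|xxj n √x| * x^((n:ℝ)/2)) * (p^(a.re-1) * Real.exp (-(x * p))) := by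
      refine setIntegral_congr_fun measurableSet_Ioi fun p hp => ?_
      simp only [hf]
      rw [norm_mul, xx_cint_norm a x p hp, Complex.norm_real, norm_mul, Real.norm_eq_abs, Real.norm_eq_abs,
        abs_of_nonneg (a := √x^n) (by positivity), hsq x hx, Complex.ofReal_re]
    rw [this, integral_const_mul, Real.integral_rpow_mul_exp_neg_mul_Ioi ha0 hx, one_div, Real.inv_rpow hx.le,
      ← Real.rpow_neg hx.le, show s.re - 1 = (n:ℝ)/2 + -a.re by rw [har]; ring, Real.rpow_add hx]
    ring
  have hInteg : Integrable (Function.uncurry f) ((volume.restrict (Ioi (0:ℝ))).prod (volume.restrict (Ioi (0:ℝ)))) := by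
    rw [integrable_prod_iff hfm.aestronglyMeasurable]
    constructor
    · filter_upwards [ae_restrict_mem measurableSet_Ioi] with x hx
      have := (xx_cint a x ha0 (by simpa using hx)).const_mul ((xxj n √x * √x^n : ℝ) : ℂ)
      exact this
    · refine IntegrableOn.congr_fun ((xxj_int n hn s.re h0 h1).const_mul (Real.Gamma a.re)) (fun x hx => ?_) measurableSet_Ioi
      exact (hnorm x hx).symm
  have hswap := integral_integral_swap hInteg
  have hL : ∫ x in Ioi (0:ℝ), ∫ p in Ioi (0:ℝ), f x p = Complex.Gamma a * ∫ x in Ioi (0:ℝ), (xxj n √x : ℂ) * (x:ℂ)^(s-1) := by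
    rw [← integral_const_mul]
    refine setIntegral_congr_fun measurableSet_Ioi fun x hx => ?_
    have hx : 0 < x := hx
    simp only [hf]
    rw [integral_const_mul, xx_cgamma a x ha0 (by simpa using hx), hsq x hx,
      show s - 1 = (((n:ℝ)/2 : ℝ) : ℂ) + -a by rw [ha]; push_cast; ring,
      Complex.cpow_add _ _ (by exact_mod_cast hx.ne'), Complex.ofReal_mul, Complex.ofReal_cpow hx.le]
    ring
  have hR : ∫ p in Ioi (0:ℝ), ∫ x in Ioi (0:ℝ), f x p = Complex.Gamma ((n:ℂ)/2 + s) := by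
    have h3 : ∀ p ∈ Ioi (0:ℝ), ∫ x in Ioi (0:ℝ), f x p = (p:ℂ)^((a - (n+1)) - 1) • ((Real.exp (-p⁻¹) : ℝ) : ℂ) := by
      intro p hp
      have hp : 0 < p := hp
      have : ∫ x in Ioi (0:ℝ), f x p = ∫ x in Ioi (0:ℝ), (p:ℂ)^(a-1) * ((xxj n √x * √x^n * Real.exp (-(p * x)) : ℝ) : ℂ) := by
        refine setIntegral_congr_fun measurableSet_Ioi fun x hx => ?_
        simp only [hf]
        push_cast
        rw [mul_comm (x:ℂ) p]; ring
      rw [this, integral_const_mul, integral_complex_ofReal, xx_laplace n p hp, smul_eq_mul,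
        show a - (n+1) - 1 = (a - 1) - ((n+1:ℕ):ℂ) by push_cast; ring, Complex.cpow_sub (a-1) _ (by exact_mod_cast hp.ne'),
        Complex.cpow_natCast]
      push_cast
      simp only [one_div, inv_pow]
      ring
    rw [setIntegral_congr_fun measurableSet_Ioi h3]
    have h4 := mellin_comp_inv (fun t : ℝ => ((Real.exp (-t) : ℝ) : ℂ)) (a - (n+1))
    rw [show -(a - (n+1)) = (n:ℂ)/2 + s by rw [ha]; ring, ← Complex.GammaIntegral_eq_mellin,
      ← Complex.Gamma_eq_integral hb0] at h4
    exact h4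
  rw [eq_div_iff hG, mul_comm, ← hL, hswap, hR]

def xxA (x t : ℝ) : ℝ := ‖(x:ℂ) + t * Complex.I‖ / x

lemma xxA_ge (x t : ℝ) (hx : 0 < x) : 1 ≤ xxA x t := by
  unfold xxA
  rw [one_le_div hx]
  have := Complex.re_le_norm ((x:ℂ) + t * Complex.I)
  simpa using this

lemma xxA_int (x : ℝ) (hx : 0 < x) : Integrable (fun t : ℝ => (xxA x t)^(-(5/4):ℝ)) := by
  have := (integrable_rpow_neg_one_add_norm_sq (E := ℝ) (μ := volume) (r := 5/4) (by simp; norm_num)).comp_div hx.ne'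
  refine this.congr (Filter.Eventually.of_forall fun t => ?_)
  simp only [xxA]
  rw [xx_norm t x hx, ← Real.rpow_mul (by positivity), Real.norm_eq_abs, sq_abs, div_pow]
  congr 1; norm_num

lemma xx_young (A B : ℝ) (hA : 1 ≤ A) (hB : 1 ≤ B) :
    A^(-(5/6):ℝ) * B^(-(5/12):ℝ) ≤ A^(-(5/4):ℝ) + B^(-(5/4):ℝ) := by
  have a0 : 0 < A := by linarith
  have b0 : 0 < B := by linarith
  rcases le_total A B with h | h
  · have : B^(-(5/12):ℝ) ≤ A^(-(5/12):ℝ) := Real.rpow_le_rpow_of_nonpos a0 h (by norm_num)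
    calc _ ≤ A^(-(5/6):ℝ) * A^(-(5/12):ℝ) := by gcongr
      _ = A^(-(5/4):ℝ) := by rw [← Real.rpow_add a0]; norm_num
      _ ≤ _ := by have := Real.rpow_nonneg b0.le (-(5/4):ℝ); linarith
  · have : A^(-(5/6):ℝ) ≤ B^(-(5/6):ℝ) := Real.rpow_le_rpow_of_nonpos b0 h (by norm_num)
    calc _ ≤ B^(-(5/6):ℝ) * B^(-(5/12):ℝ) := by gcongr
      _ = B^(-(5/4):ℝ) := by rw [← Real.rpow_add b0]; norm_num
      _ ≤ _ := by have := Real.rpow_nonneg a0.le (-(5/4):ℝ); linarith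

lemma xx_gbound : ∃ C, 0 ≤ C ∧ ∀ t : ℝ, ‖Complex.Gamma ((1/12 : ℂ) + t * Complex.I)‖ ≤
    C * (xxA (1/12) t)^(-(5/12):ℝ) * Real.exp (-(π/2 * |t|)) := by
  have g1 : 0 < Real.Gamma (1/12) := Real.Gamma_pos_of_pos (by norm_num)
  have g2 : 0 < Real.Gamma (1/12+5/12) := Real.Gamma_pos_of_pos (by norm_num)
  refine ⟨Real.Gamma (1/12) / Real.Gamma (1/12+5/12) * √(2 * π), by positivity, fun t => ?_⟩
  have h := xx_gamma (1/12) t (5/12) (by norm_num) (by norm_num) (by norm_num)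
  have h2 := xx_half t
  rw [show ((1/12:ℝ)+5/12) = 1/2 by norm_num] at h ⊢
  rw [show ((1/12:ℝ):ℂ) = 1/12 by push_cast; rfl] at h
  have e : (‖(1/12:ℂ) + t * Complex.I‖ / (1/12)) = xxA (1/12) t := by
    unfold xxA; push_cast; rfl
  rw [e] at h
  have := xxA_ge (1/12) t (by norm_num)
  rw [show ((1/12:ℝ)+5/12) = 1/2 by norm_num] at g2
  calc _ ≤ _ := h
    _ ≤ Real.Gamma (1 / 12) / Real.Gamma (1 / 2) * xxA (1 / 12) t ^ (-(5 / 12):ℝ) * (√(2 * π) * Real.exp (-(π / 2 * |t|))) := by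
      gcongr
    _ = _ := by ring

lemma xx_qbound (n : ℕ) : ∃ C, 0 ≤ C ∧ ∀ t : ℝ, ‖Qfun (n+1) ((1/12 : ℂ) + t * Complex.I)‖ ≤
    C * (xxA ((n:ℝ)/2+1/12) t)^(-(5/6):ℝ) := by
  set x : ℝ := (n:ℝ)/2+1/12 with hx
  have hx0 : 0 < x := by positivity
  have g1 : 0 < Real.Gamma x := Real.Gamma_pos_of_pos hx0
  have g2 : 0 < Real.Gamma (x+5/6) := Real.Gamma_pos_of_pos (by positivity)
  refine ⟨Real.Gamma x / Real.Gamma (x+5/6), by positivity, fun t => ?_⟩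
  have h := xx_gamma x t (5/6) hx0 (by norm_num) (by norm_num)
  unfold Qfun
  rw [norm_div]
  have e1 : (((n+1:ℕ):ℂ) - 1)/2 + ((1/12 : ℂ) + t * Complex.I) = (x:ℂ) + t * Complex.I := by
    rw [hx]; push_cast; ring
  have e2 : (((n+1:ℕ):ℂ) + 1)/2 - ((1/12 : ℂ) + t * Complex.I) = (starRingEnd ℂ) (((x+5/6:ℝ):ℂ) + t * Complex.I) := by
    rw [map_add, map_mul, Complex.conj_I, Complex.conj_ofReal, Complex.conj_ofReal, hx]; push_cast; ring
  rw [e1, e2, Complex.Gamma_conj, Complex.norm_conj, div_le_iff₀]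
  · exact h
  · rw [norm_pos_iff]
    apply Complex.Gamma_ne_zero_of_re_pos
    simp; positivity

lemma xx_expbound (ε φ : ℝ) (hε : |ε| = 1) (hφ : 0 ≤ φ) (τ : ℝ) :
    ‖Complex.exp ((ε:ℂ) * Complex.I * φ * ((1/12 : ℂ) + τ * Complex.I))‖ ≤ Real.exp (φ * |τ|) := by
  rw [Complex.norm_exp]
  apply Real.exp_le_exp.2
  have : ((ε:ℂ) * Complex.I * φ * ((1/12 : ℂ) + τ * Complex.I)).re = φ * (-(ε * τ)) := by
    rw [show (ε:ℂ) * Complex.I * φ * ((1/12 : ℂ) + τ * Complex.I) = ((φ * (-(ε * τ)) : ℝ):ℂ) + ((ε * φ /12 : ℝ) : ℂ) * Complex.I by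
      push_cast
      linear_combination (ε:ℂ) * φ * τ * Complex.I_sq]
    simp
  rw [this]
  gcongr
  calc _ ≤ |ε * τ| := neg_le_abs _
    _ = _ := by rw [abs_mul, hε, one_mul]

/-- the weight in the vertical integral, for `τ` -/
def xxg (ε φ τ : ℝ) : ℂ := Complex.Gamma ((1/12 : ℂ) + τ * Complex.I) *
  Complex.exp ((ε:ℂ) * Complex.I * φ * ((1/12 : ℂ) + τ * Complex.I))

lemma xxg_bound : ∃ C, 0 ≤ C ∧ ∀ ε φ τ : ℝ, |ε| = 1 → 0 ≤ φ → ‖xxg ε φ τ‖ ≤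
    C * (xxA (1/12) τ)^(-(5/12):ℝ) * Real.exp (-((π/2-φ) * |τ|)) := by
  obtain ⟨C, hC0, hC⟩ := xx_gbound
  refine ⟨C, hC0, fun ε φ τ hε hφ => ?_⟩
  unfold xxg
  rw [norm_mul]
  have := xxA_ge (1/12) τ (by norm_num)
  calc _ ≤ (C * (xxA (1/12) τ)^(-(5/12):ℝ) * Real.exp (-(π/2 * |τ|))) * Real.exp (φ * |τ|) := by
        gcongr
        · exact hC τ
        · exact xx_expbound ε φ hε hφ τ
    _ = _ := by rw [mul_assoc, ← Real.exp_add]; congr 2; ring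

lemma xxg_cont (ε φ : ℝ) : Continuous (xxg ε φ) := by
  unfold xxg
  apply Continuous.mul
  · rw [continuous_iff_continuousAt]
    intro τ
    apply ContinuousAt.comp (g := Complex.Gamma)
    · apply (Complex.differentiableAt_Gamma _ ?_).continuousAt
      intro m h
      have := congrArg Complex.re h
      simp at this
      have : (0:ℝ) ≤ m := by positivity
      linarith
    · fun_prop
  · fun_prop

lemma xx_expabs_int (b : ℝ) (hb : 0 < b) : Integrable (fun t : ℝ => Real.exp (-(b * |t|))) := by
  have h1 : IntegrableOn (fun t : ℝ => Real.exp (-(b * |t|))) (Ioi 0) := by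
    refine (integrableOn_exp_mul_Ioi (a := -b) (by linarith) 0).congr_fun (fun t ht => ?_) measurableSet_Ioi
    have ht : 0 < t := ht
    simp only [abs_of_pos ht]; congr 1; ring
  have h2 : IntegrableOn (fun t : ℝ => Real.exp (-(b * |t|))) (Iic 0) := by
    refine (integrableOn_exp_mul_Iic hb 0).congr_fun (fun t ht => ?_) measurableSet_Iic
    have ht : t ≤ 0 := ht
    simp only [abs_of_nonpos ht]; congr 1; ring
  have := h2.union h1
  rwa [Iic_union_Ioi, integrableOn_univ] at this

lemma xxg_int (ε φ : ℝ) (hε : |ε| = 1) (h0 : 0 ≤ φ) (h1 : φ < π/2) : Integrable (xxg ε φ) := by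
  obtain ⟨C, hC0, hC⟩ := xxg_bound
  refine ((xx_expabs_int (π/2-φ) (by linarith)).const_mul C).mono' (xxg_cont ε φ).aestronglyMeasurable ?_
  refine Filter.Eventually.of_forall fun τ => (hC ε φ τ hε h0).trans ?_
  have := xxA_ge (1/12) τ (by norm_num)
  have : (xxA (1/12) τ)^(-(5/12):ℝ) ≤ 1 := Real.rpow_le_one_of_one_le_of_nonpos this (by norm_num)
  gcongr
  nlinarith

lemma xx_zpow (ε φ : ℝ) (hε : |ε| = 1) (h0 : 0 ≤ φ) (h1 : φ < π/2) (w : ℂ) :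
    (Complex.exp (-((ε:ℂ) * Complex.I * φ)))^(-w) = Complex.exp ((ε:ℂ) * Complex.I * φ * w) := by
  have hb : |ε * φ| < π := by
    rw [abs_mul, hε, one_mul, abs_of_nonneg h0]; linarith [Real.pi_pos]
  have hb' := abs_lt.1 hb
  have him : (-((ε:ℂ) * Complex.I * φ)).im = -(ε * φ) := by
    rw [show -((ε:ℂ) * Complex.I * φ) = ((-(ε * φ) : ℝ) : ℂ) * Complex.I by push_cast; ring]
    simp
  rw [Complex.cpow_def_of_ne_zero (Complex.exp_ne_zero _), Complex.log_exp]
  · congr 1; ring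
  · rw [him]; linarith
  · rw [him]; linarith

lemma xx_zre (ε φ : ℝ) (hε : |ε| = 1) : (Complex.exp (-((ε:ℂ) * Complex.I * φ))).re = Real.cos φ := by
  rw [show -((ε:ℂ) * Complex.I * φ) = ((-(ε * φ) : ℝ) : ℂ) * Complex.I by push_cast; ring,
    Complex.exp_ofReal_mul_I_re, Real.cos_neg, ← Real.cos_abs, abs_mul, hε, one_mul, Real.cos_abs]

lemma xx_inv (ε φ ρ : ℝ) (hε : |ε| = 1) (h0 : 0 ≤ φ) (h1 : φ < π/2) (u : ℝ) (hu : 0 < u) :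
    ∫ t : ℝ, (u:ℂ)^(-((1/12:ℂ) + t * Complex.I)) * xxg ε φ (t + 3 * ρ) =
      (2 * π) * ((u:ℂ)^(3 * (ρ * Complex.I)) * Complex.exp (-(Complex.exp (-((ε:ℂ) * Complex.I * φ)) * u))) := by
  set z := Complex.exp (-((ε:ℂ) * Complex.I * φ)) with hz
  have hzre : 0 < z.re := by
    rw [hz, xx_zre ε φ hε]; exact Real.cos_pos_of_mem_Ioo ⟨by linarith [Real.pi_pos], h1⟩
  set f : ℝ → ℂ := fun u => (u:ℂ)^(3 * (ρ * Complex.I)) * Complex.exp (-(z * u)) with hf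
  have hconv : ∀ (s : ℂ) (u : ℝ), 0 < u → (u:ℂ)^(s-1) • f u = (u:ℂ)^((s + 3 * (ρ * Complex.I)) - 1) * Complex.exp (-(z * u)) := by
    intro s u hu
    have hu' : (u:ℂ) ≠ 0 := by exact_mod_cast hu.ne'
    rw [smul_eq_mul, hf, ← mul_assoc, ← Complex.cpow_add _ _ hu']
    congr 2; ring
  have hmel : ∀ s : ℂ, 0 < s.re → mellin f s = Complex.Gamma (s + 3 * (ρ * Complex.I)) * Complex.exp ((ε:ℂ) * Complex.I * φ * (s + 3 * (ρ * Complex.I))) := by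
    intro s hs
    unfold mellin
    rw [setIntegral_congr_fun measurableSet_Ioi (fun u hu => hconv s u hu), xx_cgamma _ _ (by simpa using hs) hzre,
      hz, xx_zpow ε φ hε h0 h1, mul_comm]
  have hmel2 : ∀ t : ℝ, mellin f (((1/12:ℝ):ℂ) + t * Complex.I) = xxg ε φ (t + 3 * ρ) := by
    intro t
    rw [hmel _ (by simp)]
    unfold xxg
    rw [show ((1/12:ℝ):ℂ) + t * Complex.I + 3 * (ρ * Complex.I) = (1/12:ℂ) + ((t + 3 * ρ : ℝ):ℂ) * Complex.I by push_cast; ring]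
  have key := mellinInv_mellin_eq (1/12) f hu ?_ ?_ ?_
  · unfold mellinInv at key
    simp only [hmel2] at key
    rw [Complex.real_smul] at key
    rw [← show f u = (u:ℂ)^(3 * (ρ * Complex.I)) * Complex.exp (-(z * u)) from rfl, ← key]
    push_cast
    rw [← mul_assoc, mul_one_div_cancel (by exact_mod_cast (by positivity : (2 * π) ≠ 0)), one_mul]
    rfl
  · unfold MellinConvergent
    refine IntegrableOn.congr_fun (xx_cint ((1/12:ℝ) + 3 * (ρ * Complex.I)) z (by simp) hzre) (fun u hu => ?_) measurableSet_Ioi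
    exact (hconv _ u hu).symm
  · unfold Complex.VerticalIntegrable
    simp only [hmel2]
    exact (xxg_int ε φ hε h0 h1).comp_add_right (3 * ρ)
  · have : (u:ℂ) ∈ Complex.slitPlane := Or.inl (by simpa using hu)
    simp only [hf]
    apply ContinuousAt.mul
    · exact (Complex.continuous_ofReal.continuousAt).cpow continuousAt_const this
    · fun_prop

lemma xx_mellinQ (n : ℕ) (hn : 1 ≤ n) (t : ℝ) :
    ∫ x in Ioi (0:ℝ), (xxj n √x : ℂ) * (x:ℂ)^(((1/12:ℂ) + t * Complex.I)-1) = Qfun (n+1) ((1/12:ℂ) + t * Complex.I) := by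
  rw [xx_mellinJ n hn _ (by simp) (by simp; norm_num)]
  unfold Qfun
  congr 2 <;> (push_cast; ring)

lemma xx_reg (n : ℕ) (hn : 1 ≤ n) (ε φ ρ Y : ℝ) (hY : 0 < Y) (hε : |ε| = 1) (h0 : 0 ≤ φ) (h1 : φ < π/2) :
    ∫ t : ℝ, (Y:ℂ)^(-((1/12:ℂ) + t * Complex.I)) * Qfun (n+1) ((1/12:ℂ) + t * Complex.I) * xxg ε φ (t + 3 * ρ) =
    (2 * π) * ∫ x in Ioi (0:ℝ), (xxj n √x : ℂ) * (((Y/x : ℝ):ℂ)^(3 * (ρ * Complex.I)) *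
      Complex.exp (-(Complex.exp (-((ε:ℂ) * Complex.I * φ)) * ((Y/x : ℝ) : ℂ)))) * (1 / (x:ℂ)) := by
  set h : ℝ → ℝ → ℂ := fun t x => ((Y:ℂ)^(-((1/12:ℂ) + t * Complex.I)) * xxg ε φ (t + 3 * ρ)) *
    ((xxj n √x : ℂ) * (x:ℂ)^(((1/12:ℂ) + t * Complex.I)-1)) with hh
  have hm : Measurable (Function.uncurry h) := by
    have m1 : Measurable (fun p : ℝ × ℝ => xxj n √p.2) := (xxj_cont n).measurable.comp measurable_snd
    have m2 : Measurable (fun p : ℝ × ℝ => xxg ε φ (p.1 + 3 * ρ)) :=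
      (xxg_cont ε φ).measurable.comp (measurable_fst.add_const _)
    simp only [hh, Function.uncurry_def]
    fun_prop
  have hInteg : Integrable (Function.uncurry h) (volume.prod (volume.restrict (Ioi (0:ℝ)))) := by
    have i1 := (((xxg_int ε φ hε h0 h1).comp_add_right (3 * ρ)).norm.const_mul (Y^(-(1/12):ℝ)))
    have i2 := xxj_int n hn (1/12) (by norm_num) (by norm_num)
    refine (i1.mul_prod i2).mono' hm.aestronglyMeasurable ?_
    have hae : ∀ᵐ p : ℝ × ℝ ∂(volume.prod (volume.restrict (Ioi (0:ℝ)))), p.2 ∈ Ioi (0:ℝ) :=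
      Measure.quasiMeasurePreserving_snd.ae (ae_restrict_mem measurableSet_Ioi)
    filter_upwards [hae] with p hp
    have hp : 0 < p.2 := hp
    simp only [hh, Function.uncurry_def]
    rw [norm_mul, norm_mul, norm_mul, Complex.norm_cpow_eq_rpow_re_of_pos hY, Complex.norm_cpow_eq_rpow_re_of_pos hp,
      Complex.norm_real, Real.norm_eq_abs]
    apply le_of_eq
    congr 3
    · simp
    · simp
  have hswap := integral_integral_swap hInteg
  have hL : ∀ t : ℝ, ∫ x in Ioi (0:ℝ), h t x = (Y:ℂ)^(-((1/12:ℂ) + t * Complex.I)) * Qfun (n+1) ((1/12:ℂ) + t * Complex.I) * xxg ε φ (t + 3 * ρ) := by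
    intro t
    simp only [hh]
    rw [integral_const_mul, xx_mellinQ n hn t]; ring
  simp_rw [hL] at hswap
  rw [hswap, ← integral_const_mul]
  refine setIntegral_congr_fun measurableSet_Ioi fun x hx => ?_
  have hx : 0 < x := hx
  have hx' : (x:ℂ) ≠ 0 := by exact_mod_cast hx.ne'
  have e : ∀ t : ℝ, h t x = ((xxj n √x : ℂ) * (1/(x:ℂ))) * (((Y/x:ℝ):ℂ)^(-((1/12:ℂ) + t * Complex.I)) * xxg ε φ (t + 3 * ρ)) := by
    intro t
    simp only [hh]
    have e1 : ((Y/x:ℝ):ℂ)^(-((1/12:ℂ) + t * Complex.I)) = (Y:ℂ)^(-((1/12:ℂ) + t * Complex.I)) * (x:ℂ)^((1/12:ℂ) + t * Complex.I) := by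
      rw [div_eq_mul_inv, Complex.ofReal_mul, Complex.mul_cpow_ofReal_nonneg hY.le (by positivity), Complex.ofReal_inv,
        Complex.inv_cpow _ _ (by rw [Complex.arg_ofReal_of_nonneg hx.le]; exact Real.pi_pos.ne), Complex.cpow_neg (x:ℂ), inv_inv]
    rw [e1, Complex.cpow_sub _ _ hx', Complex.cpow_one]
    ring
  simp only [e]
  rw [integral_const_mul, xx_inv ε φ ρ hε h0 h1 (Y/x) (by positivity)]
  ring

lemma xx_Qmeas (n : ℕ) : Measurable (fun t : ℝ => Qfun (n+1) ((1/12:ℂ) + t * Complex.I)) := by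
  have g : ∀ (x : ℝ) (c : ℝ), 0 < x → Continuous (fun t : ℝ => Complex.Gamma ((x:ℂ) + c * (t * Complex.I))) := by
    intro x c hx
    rw [continuous_iff_continuousAt]
    intro τ
    apply ContinuousAt.comp (g := Complex.Gamma)
    · apply (Complex.differentiableAt_Gamma _ ?_).continuousAt
      intro m h
      have := congrArg Complex.re h
      simp at this
      have : (0:ℝ) ≤ m := by positivity
      linarith
    · fun_prop
  have a := (g ((n:ℝ)/2+1/12) 1 (by positivity)).measurable
  have b := (g ((n:ℝ)/2+11/12) (-1) (by positivity)).measurable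
  convert a.div b using 1
  funext t
  simp only [Qfun, Pi.div_apply]
  congr 2 <;> (push_cast; ring)

lemma xx_main (n : ℕ) (hn : 1 ≤ n) (ε ρ Y : ℝ) (hY : 0 < Y) (hε : |ε| = 1) :
    ∫ t : ℝ, (Y:ℂ)^(-((1/12:ℂ) + t * Complex.I)) * Qfun (n+1) ((1/12:ℂ) + t * Complex.I) * xxg ε (π/2) (t + 3 * ρ) =
    (2 * π) * ∫ x in Ioi (0:ℝ), (xxj n √x : ℂ) * (((Y/x : ℝ):ℂ)^(3 * (ρ * Complex.I)) *
      Complex.exp (-(Complex.exp (-((ε:ℂ) * Complex.I * ((π/2:ℝ):ℂ))) * ((Y/x : ℝ) : ℂ)))) * (1 / (x:ℂ)) := by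
  set l : Filter ℝ := nhdsWithin (π/2) (Iio (π/2)) with hl
  have hev : ∀ᶠ φ in l, 0 ≤ φ ∧ φ < π/2 := by
    have h1 : ∀ᶠ φ in l, φ ∈ Iio (π/2) := self_mem_nhdsWithin
    have h2 : ∀ᶠ φ in l, (0:ℝ) < φ := nhdsWithin_le_nhds (lt_mem_nhds (by positivity))
    filter_upwards [h1, h2] with φ a b
    exact ⟨b.le, a⟩
  have hlim : Filter.Tendsto (fun φ : ℝ => φ) l (nhds (π/2)) := nhdsWithin_le_nhds
  have hz : ∀ (φ x : ℝ), 0 < x → 0 ≤ φ → φ ≤ π/2 → ‖(xxj n √x : ℂ) * (((Y/x : ℝ):ℂ)^(3 * (ρ * Complex.I)) *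
      Complex.exp (-(Complex.exp (-((ε:ℂ) * Complex.I * (φ:ℂ))) * ((Y/x : ℝ) : ℂ)))) * (1 / (x:ℂ))‖ ≤ |xxj n √x| * x^((0:ℝ)-1) := by
    intro φ x hx h0 h1
    rw [norm_mul, norm_mul, norm_mul, Complex.norm_real, Real.norm_eq_abs, Complex.norm_cpow_eq_rpow_re_of_pos (by positivity),
      Complex.norm_exp, Complex.neg_re, Complex.re_mul_ofReal, xx_zre ε φ hε, norm_div, norm_one, Complex.norm_of_nonneg hx.le,
      zero_sub, Real.rpow_neg_one, one_div]
    have : (3 * ((ρ:ℂ) * Complex.I)).re = 0 := by simp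
    rw [this, Real.rpow_zero, one_mul]
    have hc : 0 ≤ Real.cos φ := Real.cos_nonneg_of_mem_Icc ⟨by linarith [Real.pi_pos], h1⟩
    have : Real.exp (-(Real.cos φ * (Y/x))) ≤ 1 := Real.exp_le_one_iff.2 (by
      have : 0 ≤ Real.cos φ * (Y/x) := by positivity
      linarith)
    gcongr
    exact mul_le_of_le_one_right (abs_nonneg _) this
  have T1 : Filter.Tendsto (fun φ : ℝ => ∫ x in Ioi (0:ℝ), (xxj n √x : ℂ) * (((Y/x : ℝ):ℂ)^(3 * (ρ * Complex.I)) *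
      Complex.exp (-(Complex.exp (-((ε:ℂ) * Complex.I * (φ:ℂ))) * ((Y/x : ℝ) : ℂ)))) * (1 / (x:ℂ))) l
      (nhds (∫ x in Ioi (0:ℝ), (xxj n √x : ℂ) * (((Y/x : ℝ):ℂ)^(3 * (ρ * Complex.I)) *
      Complex.exp (-(Complex.exp (-((ε:ℂ) * Complex.I * ((π/2:ℝ):ℂ))) * ((Y/x : ℝ) : ℂ)))) * (1 / (x:ℂ)))) := by
    refine tendsto_integral_filter_of_dominated_convergence (fun x => |xxj n √x| * x^((0:ℝ)-1)) ?_ ?_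
      (xxj_int n hn 0 le_rfl (by norm_num)) ?_
    · refine Filter.Eventually.of_forall fun φ => ?_
      have := (xxj_cont n).measurable
      apply Measurable.aestronglyMeasurable
      fun_prop
    · filter_upwards [hev] with φ hφ
      filter_upwards [ae_restrict_mem measurableSet_Ioi] with x hx
      exact hz φ x hx hφ.1 hφ.2.le
    · refine Filter.Eventually.of_forall fun x => ?_
      have : Continuous (fun φ : ℝ => (xxj n √x : ℂ) * (((Y/x : ℝ):ℂ)^(3 * (ρ * Complex.I)) *
        Complex.exp (-(Complex.exp (-((ε:ℂ) * Complex.I * (φ:ℂ))) * ((Y/x : ℝ) : ℂ)))) * (1 / (x:ℂ))) := by fun_prop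
      exact (this.tendsto (π/2)).comp hlim
  obtain ⟨Cg, hCg0, hCg⟩ := xxg_bound
  obtain ⟨Cq, hCq0, hCq⟩ := xx_qbound n
  have hx0 : 0 < (n:ℝ)/2+1/12 := by positivity
  have T2 : Filter.Tendsto (fun φ : ℝ => ∫ t : ℝ, (Y:ℂ)^(-((1/12:ℂ) + t * Complex.I)) * Qfun (n+1) ((1/12:ℂ) + t * Complex.I) * xxg ε φ (t + 3 * ρ)) l
      (nhds (∫ t : ℝ, (Y:ℂ)^(-((1/12:ℂ) + t * Complex.I)) * Qfun (n+1) ((1/12:ℂ) + t * Complex.I) * xxg ε (π/2) (t + 3 * ρ))) := by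
    refine tendsto_integral_filter_of_dominated_convergence
      (fun t => (Y^(-(1/12):ℝ) * Cq * Cg) * ((xxA ((n:ℝ)/2+1/12) t)^(-(5/4):ℝ) + (xxA (1/12) (t + 3 * ρ))^(-(5/4):ℝ))) ?_ ?_ ?_ ?_
    · refine Filter.Eventually.of_forall fun φ => ?_
      have m1 := xx_Qmeas n
      have m2 : Measurable (fun t : ℝ => xxg ε φ (t + 3 * ρ)) := (xxg_cont ε φ).measurable.comp (measurable_id.add_const _)
      apply Measurable.aestronglyMeasurable
      fun_prop
    · filter_upwards [hev] with φ hφ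
      refine Filter.Eventually.of_forall fun t => ?_
      rw [norm_mul, norm_mul, Complex.norm_cpow_eq_rpow_re_of_pos hY]
      have e : (-((1/12:ℂ) + t * Complex.I)).re = -(1/12) := by simp
      rw [e]
      have A1 := xxA_ge ((n:ℝ)/2+1/12) t hx0
      have A2 := xxA_ge (1/12) (t + 3 * ρ) (by norm_num)
      have b1 := hCq t
      have b2 : ‖xxg ε φ (t + 3 * ρ)‖ ≤ Cg * (xxA (1/12) (t + 3 * ρ))^(-(5/12):ℝ) := by
        refine (hCg ε φ (t + 3 * ρ) hε hφ.1).trans ?_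
        refine mul_le_of_le_one_right (by positivity) (Real.exp_le_one_iff.2 ?_)
        have : 0 ≤ (π/2-φ) * |t + 3 * ρ| := mul_nonneg (by linarith [hφ.2]) (abs_nonneg _)
        linarith
      calc _ ≤ Y^(-(1/12):ℝ) * (Cq * (xxA ((n:ℝ)/2+1/12) t)^(-(5/6):ℝ)) * (Cg * (xxA (1/12) (t + 3 * ρ))^(-(5/12):ℝ)) := by
            gcongr
        _ = (Y^(-(1/12):ℝ) * Cq * Cg) * ((xxA ((n:ℝ)/2+1/12) t)^(-(5/6):ℝ) * (xxA (1/12) (t + 3 * ρ))^(-(5/12):ℝ)) := by ring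
        _ ≤ _ := by
            gcongr
            exact xx_young _ _ A1 A2
    · exact ((xxA_int _ hx0).add ((xxA_int (1/12) (by norm_num)).comp_add_right (3 * ρ))).const_mul _
    · refine Filter.Eventually.of_forall fun t => ?_
      have : Continuous (fun φ : ℝ => (Y:ℂ)^(-((1/12:ℂ) + t * Complex.I)) * Qfun (n+1) ((1/12:ℂ) + t * Complex.I) * xxg ε φ (t + 3 * ρ)) := by
        unfold xxg; fun_prop
      exact (this.tendsto (π/2)).comp hlim
  have : l.NeBot := by rw [hl]; infer_instance
  refine tendsto_nhds_unique T2 ((T1.const_mul (2 * π : ℂ)).congr' ?_)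
  filter_upwards [hev] with φ hφ
  exact (xx_reg n hn ε φ ρ Y hY hε hφ.1 hφ.2).symm

/-- Bessel integral representation of `K_{w₄}`: for `d ≥ 2`, `r`
purely imaginary and `y ≠ 0` with `ε = sgn y`,
`K_{w₄}(y;d,r) = 2(εi)^d |y|^{1−r} π^{1−3r}
  ∫₀^∞ J_{d−1}(2√x) e^{2εi·4π³|y|/x} (4π³|y|/x)^{3r} dx/x`,
the integral converging absolutely. -/
theorem statement12 (d : ℕ) (hd : 2 ≤ d) (r : ℂ) (hr : r.re = 0)
    (y : ℝ) (hy : y ≠ 0) :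
    IntegrableOn (fun x : ℝ =>
        (besselJ ((d : ℝ) - 1) (2 * Real.sqrt x) : ℂ) *
          Complex.exp (2 * (Real.sign y : ℂ) * Complex.I *
            ((4 * Real.pi ^ 3 * |y| / x : ℝ) : ℂ)) *
          ((4 * Real.pi ^ 3 * |y| / x : ℝ) : ℂ) ^ (3 * r) * (1 / (x : ℂ)))
      (Set.Ioi (0 : ℝ)) ∧
    Kw4 y d r =
      2 * ((Real.sign y : ℂ) * Complex.I) ^ d * ((|y| : ℝ) : ℂ) ^ ((1 : ℂ) - r) *
        (Real.pi : ℂ) ^ ((1 : ℂ) - 3 * r) *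
        ∫ x in Set.Ioi (0 : ℝ),
          (besselJ ((d : ℝ) - 1) (2 * Real.sqrt x) : ℂ) *
            Complex.exp (2 * (Real.sign y : ℂ) * Complex.I *
              ((4 * Real.pi ^ 3 * |y| / x : ℝ) : ℂ)) *
            ((4 * Real.pi ^ 3 * |y| / x : ℝ) : ℂ) ^ (3 * r) * (1 / (x : ℂ)) := by
  obtain ⟨n, rfl⟩ : ∃ n, d = n + 1 := ⟨d - 1, by omega⟩
  have hn : 1 ≤ n := by omega
  obtain ⟨ρ, rfl⟩ : ∃ ρ : ℝ, r = ρ * Complex.I := ⟨r.im, by apply Complex.ext <;> simp [hr]⟩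
  have hε : |Real.sign y| = 1 := by
    rcases lt_or_gt_of_ne hy with h | h
    · rw [Real.sign_of_neg h]; simp
    · rw [Real.sign_of_pos h]; simp
  set ε := Real.sign y with hεd
  have hy' : 0 < |y| := abs_pos.2 hy
  have hpi := Real.pi_pos
  set A : ℝ := 4 * Real.pi ^ 3 * |y| with hA
  have hA0 : 0 < A := by positivity
  have hAY : |8 * Real.pi ^ 3 * y| = 2 * A := by
    rw [abs_mul, abs_of_pos (by positivity : (0:ℝ) < 8 * π^3), hA]; ring
  constructor
  · have h1 := xxj_int n hn 0 le_rfl (by norm_num)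
    have h2 : IntegrableOn (fun x : ℝ => ((xxj n √x : ℝ) : ℂ) *
          Complex.exp (2 * (ε : ℂ) * Complex.I * ((A / x : ℝ) : ℂ)) *
          ((A / x : ℝ) : ℂ) ^ (3 * ((ρ:ℂ) * Complex.I)) * (1 / (x : ℂ))) (Ioi 0) := by
      refine Integrable.mono' h1 ?_ ?_
      · have := (xxj_cont n).measurable
        apply Measurable.aestronglyMeasurable
        fun_prop
      · refine (ae_restrict_iff' measurableSet_Ioi).2 (Filter.Eventually.of_forall fun x hx => ?_)
        have hx : 0 < x := hx
        rw [norm_mul, norm_mul, norm_mul, Complex.norm_cpow_eq_rpow_re_of_pos (by positivity), Complex.norm_exp,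
          zero_sub, Real.rpow_neg_one]
        simp [abs_of_pos hx]
    refine h2.congr_fun (fun x hx => ?_) measurableSet_Ioi
    simp only [xx_bessel n x hx]
  · have hI : ∫ x in Ioi (0:ℝ), (besselJ (((n+1:ℕ) : ℝ) - 1) (2 * Real.sqrt x) : ℂ) *
            Complex.exp (2 * (ε : ℂ) * Complex.I * ((A / x : ℝ) : ℂ)) *
            ((A / x : ℝ) : ℂ) ^ (3 * ((ρ:ℂ) * Complex.I)) * (1 / (x : ℂ)) =
        ((2:ℂ)^(3 * ((ρ:ℂ) * Complex.I)))⁻¹ * ∫ x in Ioi (0:ℝ), (xxj n √x:ℂ) * (((2*A/x:ℝ):ℂ)^(3*((ρ:ℂ)*Complex.I)) * Complex.exp (-(Complex.exp (-((ε:ℂ)*Complex.I*((π/2:ℝ):ℂ))) * ((2*A/x:ℝ):ℂ)))) * (1/(x:ℂ)) := by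
      rw [← integral_const_mul]
      refine setIntegral_congr_fun measurableSet_Ioi fun x hx => ?_
      have hx' : 0 < x := hx
      have hz : Complex.exp (-((ε:ℂ)*Complex.I*((π/2:ℝ):ℂ))) = -(ε * Complex.I) := by
        rcases lt_or_gt_of_ne hy with h | h
        · rw [hεd, Real.sign_of_neg h]
          rw [show -(((-1:ℝ):ℂ) * Complex.I * ((π/2:ℝ):ℂ)) = (π:ℂ)/2 * Complex.I by push_cast; ring, Complex.exp_pi_div_two_mul_I]
          simp
        · rw [hεd, Real.sign_of_pos h]
          rw [show -(((1:ℝ):ℂ) * Complex.I * ((π/2:ℝ):ℂ)) = -((π:ℂ)/2 * Complex.I) by push_cast; ring, Complex.exp_neg, Complex.exp_pi_div_two_mul_I]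
          simp
      have e2 : ((2*A/x:ℝ):ℂ)^(3*((ρ:ℂ)*Complex.I)) = (2:ℂ)^(3*((ρ:ℂ)*Complex.I)) * ((A/x:ℝ):ℂ)^(3*((ρ:ℂ)*Complex.I)) := by
        rw [mul_div_assoc, Complex.ofReal_mul, Complex.mul_cpow_ofReal_nonneg (by norm_num) (by positivity)]
        norm_num
      have h20 : (2:ℂ)^(3*((ρ:ℂ)*Complex.I)) ≠ 0 := by simp [Complex.cpow_eq_zero_iff]
      have e3 : -(-((ε:ℂ) * Complex.I) * ((2*A/x:ℝ):ℂ)) = 2 * (ε : ℂ) * Complex.I * ((A / x : ℝ) : ℂ) := by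
        push_cast; ring
      simp only [xx_bessel n x hx, hz, e2, e3]
      field_simp
    have hK : ∫ t : ℝ, ((|8 * Real.pi ^ 3 * y| : ℝ) : ℂ) ^
          ((1 : ℂ) - ρ * Complex.I - ((1 / 12 : ℂ) + (t : ℂ) * Complex.I)) *
        Qfun (n+1) ((1 / 12 : ℂ) + (t : ℂ) * Complex.I) *
        Complex.Gamma ((1 / 12 : ℂ) + (t : ℂ) * Complex.I + 3 * (ρ * Complex.I)) *
        Complex.exp ((ε : ℂ) * Complex.I * (Real.pi : ℂ) *
          ((1 / 12 : ℂ) + (t : ℂ) * Complex.I + 3 * (ρ * Complex.I)) / 2) =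
        ((2*A:ℝ):ℂ)^((1:ℂ) - ρ * Complex.I) * ∫ t : ℝ, ((2*A:ℝ):ℂ)^(-((1/12:ℂ)+t*Complex.I)) * Qfun (n+1) ((1/12:ℂ)+t*Complex.I) * xxg ε (π/2) (t+3*ρ) := by
      rw [← integral_const_mul]
      congr 1; ext t
      have hne : ((2*A:ℝ):ℂ) ≠ 0 := by exact_mod_cast (by positivity : (2*A) ≠ 0)
      rw [hAY, sub_eq_add_neg _ ((1 / 12 : ℂ) + (t : ℂ) * Complex.I), Complex.cpow_add _ _ hne, xxg]
      have a1 : (1 / 12 : ℂ) + (t : ℂ) * Complex.I + 3 * (ρ * Complex.I) = (1/12:ℂ) + ((t+3*ρ:ℝ):ℂ) * Complex.I := by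
        push_cast; ring
      rw [a1]
      have a2 : (ε : ℂ) * Complex.I * (Real.pi : ℂ) * ((1/12:ℂ) + ((t+3*ρ:ℝ):ℂ) * Complex.I) / 2 = (ε:ℂ) * Complex.I * ((π/2:ℝ):ℂ) * ((1/12:ℂ) + ((t+3*ρ:ℝ):ℂ) * Complex.I) := by
        push_cast; ring
      rw [a2]
      ring
    unfold Kw4
    rw [← hεd, hK, xx_main n hn ε ρ (2*A) (by positivity) hε, hI]
    have hpc : (π:ℂ) ≠ 0 := by exact_mod_cast hpi.ne'
    have h20 : (2:ℂ)^(3*((ρ:ℂ)*Complex.I)) ≠ 0 := by simp [Complex.cpow_eq_zero_iff]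
    have hc : ((2*A:ℝ):ℂ)^((1:ℂ) - ρ * Complex.I) = 8 * π^2 * ((|y|:ℝ):ℂ)^((1:ℂ) - ρ * Complex.I) * (π:ℂ)^((1:ℂ) - 3 * (ρ * Complex.I)) * ((2:ℂ)^(3*((ρ:ℂ)*Complex.I)))⁻¹ := by
      have b1 : (2*A:ℝ) = 2^3 * π^3 * |y| := by rw [hA]; ring
      have c3 : ∀ x : ℝ, 0 < x → ((x^3:ℝ):ℂ)^((1:ℂ) - ρ * Complex.I) = (x:ℂ)^3 * ((x:ℂ)^(3*((ρ:ℂ)*Complex.I)))⁻¹ := by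
        intro x hx
        have hx' : (x:ℂ) ≠ 0 := by exact_mod_cast hx.ne'
        rw [show x^3 = x * x * x by ring, Complex.ofReal_mul, Complex.mul_cpow_ofReal_nonneg (by positivity) hx.le,
          Complex.ofReal_mul, Complex.mul_cpow_ofReal_nonneg hx.le hx.le, ← Complex.cpow_add _ _ hx', ← Complex.cpow_add _ _ hx',
          ← Complex.cpow_neg, ← Complex.cpow_natCast, ← Complex.cpow_add _ _ hx']
        congr 1; push_cast; ring
      rw [b1, Complex.ofReal_mul, Complex.mul_cpow_ofReal_nonneg (by positivity) hy'.le, Complex.ofReal_mul,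
        Complex.mul_cpow_ofReal_nonneg (by positivity) (by positivity), c3 2 two_pos, c3 π hpi,
        Complex.cpow_sub _ _ hpc, Complex.cpow_one]
      push_cast
      ring
    rw [hc]
    field_simp
    ring
end
end
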